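/- Let A and B be F-multiplicity-free skew shapes of the same size. If rows_k(A) ⊴ rows_k(B) for all k ≥ 1, then Fsupp(A) ⊇ Fsupp(B). -/

import Mathlib

namespace SkewPaper

open Finset

/-- A skew shape `λ/μ`, given by Young diagrams `μ ≤ λ`. -/
structure SkewShape where
  lam : YoungDiagram
  mu : YoungDiagram
  sub : mu ≤ lam

namespace SkewShape

/-- The cells (boxes) of the skew shape `λ/μ`. -/
def cells (A : SkewShape) : Finset (ℕ × ℕ) :=
  A.lam.cells \ A.mu.cells

/-- The number of boxes of `A`. -/
def size (A : SkewShape) : ℕ := A.cells.card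

end SkewShape

/-- The set of columns occupied by row `i` of the cell set `s`. -/
def rowCols (s : Finset (ℕ × ℕ)) (i : ℕ) : Finset ℕ :=
  (s.filter (fun c => c.1 = i)).image Prod.snd

/-- The set of rows occupied by column `j` of the cell set `s`. -/
def colRows (s : Finset (ℕ × ℕ)) (j : ℕ) : Finset ℕ :=
  (s.filter (fun c => c.2 = j)).image Prod.fst

/-- `overlapRow s k i` : the number of columns occupied in common by
rows `i, i+1, …, i+k-1` of `s`. -/
def overlapRow (s : Finset (ℕ × ℕ)) (k i : ℕ) : ℕ :=
  ((rowCols s i).filter (fun j => ∀ t, t < k → j ∈ rowCols s (i + t))).card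

/-- `overlapCol s l j` : the number of rows occupied in common by
columns `j, j+1, …, j+l-1` of `s`. -/
def overlapCol (s : Finset (ℕ × ℕ)) (l j : ℕ) : ℕ :=
  ((colRows s j).filter (fun i => ∀ t, t < l → i ∈ colRows s (j + t))).card

/-- `rows_k`: the partition (as the multiset of its nonzero parts) of overlaps of
`k` consecutive rows. -/
def rowsk (s : Finset (ℕ × ℕ)) (k : ℕ) : Multiset ℕ :=
  ((s.image Prod.fst).val.map (overlapRow s k)).filter (fun m => 0 < m)

/-- `cols_l`: the partition (as the multiset of its nonzero parts) of overlaps of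
`l` consecutive columns. -/
def colsk (s : Finset (ℕ × ℕ)) (l : ℕ) : Multiset ℕ :=
  ((s.image Prod.snd).val.map (overlapCol s l)).filter (fun m => 0 < m)

/-- `rects s k l`: the number of `k × l` rectangles of boxes contained inside `s`. -/
def rects (s : Finset (ℕ × ℕ)) (k l : ℕ) : ℕ :=
  (s.filter (fun c => ∀ a, a < k → ∀ b, b < l → (c.1 + a, c.2 + b) ∈ s)).card

/-- The weakly decreasing sorted list of a multiset: the partition with those parts. -/
def sortDesc (s : Multiset ℕ) : List ℕ := (s.sort (· ≤ ·)).reverse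

/-- Dominance order on partitions presented as multisets of parts:
every partial sum of the decreasing sort of `s` is at most the corresponding
partial sum for `t` (missing parts treated as `0`). -/
def Dom (s t : Multiset ℕ) : Prop :=
  ∀ j : ℕ, ((sortDesc s).take j).sum ≤ ((sortDesc t).take j).sum

/-- The conjugate (transpose) of a partition presented as a multiset of parts. -/
def conjM (s : Multiset ℕ) : Multiset ℕ :=
  (Multiset.range s.sup).map (fun j => Multiset.card (s.filter (fun x => j < x)))

/-- A standard Young tableau of shape `A`: a bijective filling of the cells of `A`
by `1, …, |A|` which increases from left to right along rows and from top to
bottom down columns.  (Entries off the shape are normalized to `0`.) -/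
structure SYT (A : SkewShape) where
  entry : ℕ × ℕ → ℕ
  zero_off : ∀ c, c ∉ A.cells → entry c = 0
  mem_range : ∀ c ∈ A.cells, entry c ∈ Finset.Icc 1 A.size
  injOn : Set.InjOn entry ↑A.cells
  row_lt : ∀ i j j', (i, j) ∈ A.cells → (i, j') ∈ A.cells → j < j' →
    entry (i, j) < entry (i, j')
  col_lt : ∀ i i' j, (i, j) ∈ A.cells → (i', j) ∈ A.cells → i < i' →
    entry (i, j) < entry (i', j)

/-- The descent set of a standard Young tableau: those `k ∈ {1, …, n-1}` such that
`k+1` appears in a strictly lower row than `k`. -/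
def SYT.descentSet {A : SkewShape} (T : SYT A) : Finset ℕ :=
  (Finset.Ico 1 A.size).filter (fun k =>
    ∃ c ∈ A.cells, ∃ c' ∈ A.cells, T.entry c = k ∧ T.entry c' = k + 1 ∧ c.1 < c'.1)

/-- The composition of `n` corresponding to a subset `D ⊆ {1, …, n-1}`:
its partial sums are the elements of `D`. -/
def compOfSet (n : ℕ) (D : Finset ℕ) : List ℕ :=
  if n = 0 then []
  else
    let l := D.sort (· ≤ ·) ++ [n]
    List.zipWith (fun x y => x - y) l (0 :: l)

/-- The descent composition of a standard Young tableau. -/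
def SYT.descentComp {A : SkewShape} (T : SYT A) : List ℕ :=
  compOfSet A.size T.descentSet

/-- The F-support of `A`: the set of descent compositions of SYT of shape `A`. -/
def Fsupp (A : SkewShape) : Set (List ℕ) :=
  {α | ∃ T : SYT A, T.descentComp = α}

/-- The number of standard Young tableaux of shape `A` with descent composition `α`. -/
noncomputable def countSYT (A : SkewShape) (α : List ℕ) : ℕ :=
  Nat.card {T : SYT A // T.descentComp = α}

/-- `S(γ)`: the set of proper partial sums of the composition `γ`. -/
def Sset (γ : List ℕ) : Finset ℕ :=
  ((List.range (γ.length - 1)).map (fun j => (γ.take (j + 1)).sum)).toFinset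

/-- `cols(α)` for a composition `α` of `n`, as a multiset: the parts of the
composition corresponding to the complement of `S(α)` in `{1, …, n-1}`. -/
def colsComp (α : List ℕ) : Multiset ℕ :=
  ↑(compOfSet α.sum ((Finset.Icc 1 (α.sum - 1)) \ Sset α))

/-- Delete the leftmost box of every nonempty row. -/
def trimCells (s : Finset (ℕ × ℕ)) : Finset (ℕ × ℕ) :=
  s.filter (fun c => 1 ≤ c.2 ∧ (c.1, c.2 - 1) ∈ s)

/-- `s` is a ribbon whose (nonempty) rows are exactly rows `r0, …, r1`, with every
pair of adjacent rows overlapping in exactly one column. -/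
def IsRibbonOn (s : Finset (ℕ × ℕ)) (r0 r1 : ℕ) : Prop :=
  r0 ≤ r1 ∧ (∀ i, (rowCols s i).Nonempty ↔ r0 ≤ i ∧ i ≤ r1) ∧
    (∀ i, r0 ≤ i → i < r1 → (rowCols s i ∩ rowCols s (i + 1)).card = 1)

/-- `A` is a ribbon. -/
def SkewShape.IsRibbon (A : SkewShape) : Prop :=
  ∃ r0 r1, IsRibbonOn A.cells r0 r1

/-- An elongated ribbon: a ribbon all of whose rows have length at least two. -/
def ElongatedRibbon (A : SkewShape) : Prop :=
  A.IsRibbon ∧ ∀ i, (rowCols A.cells i).Nonempty → 2 ≤ (rowCols A.cells i).card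

/-- A horizontal strip: at most one box in each column. -/
def IsHorizontalStrip (A : SkewShape) : Prop :=
  ∀ j, (colRows A.cells j).card ≤ 1

/-- `A` is F-multiplicity-free: distinct SYT of shape `A` have distinct descent sets. -/
def FMultFree (A : SkewShape) : Prop :=
  ∀ T T' : SYT A, T.descentSet = T'.descentSet → T = T'

/-- The cells of a shape, viewed inside `ℤ × ℤ`. -/
def toZ (s : Finset (ℕ × ℕ)) : Finset (ℤ × ℤ) :=
  s.image (fun c => ((c.1 : ℤ), (c.2 : ℤ)))

/-- The cells of the hook `(m, 1^l)`. -/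
def hookCells (m l : ℕ) : Finset (ℕ × ℕ) :=
  ((Finset.range m).image (fun j => ((0 : ℕ), j))) ∪
    ((Finset.Icc 1 l).image (fun i => (i, (0 : ℕ))))

/-- The descent word of a list of cells: for each consecutive pair, whether the row increases. -/
def des : List (ℤ × ℤ) → List Bool
  | [] => []
  | [_] => []
  | a :: b :: l => decide (a.1 < b.1) :: des (b :: l)

/-- `a` may be listed before `b` in a linear extension. -/
def Bef (a b : ℤ × ℤ) : Prop := ¬ (b.1 ≤ a.1 ∧ b.2 ≤ a.2)

/-- `L` lists the cells of `s` in an order extending the product order. -/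
structure IsLin (s : Finset (ℤ × ℤ)) (L : List (ℤ × ℤ)) : Prop where
  mem : ∀ x, x ∈ L ↔ x ∈ s
  pw : L.Pairwise Bef

/-- Linear extensions of `s` are determined by their descent words. -/
def MultFree (s : Finset (ℤ × ℤ)) : Prop :=
  ∀ L L', IsLin s L → IsLin s L' → des L = des L' → L = L'

/-- The set of descent words of linear extensions of `s`. -/
def Supp (s : Finset (ℤ × ℤ)) : Set (List Bool) := {β | ∃ L, IsLin s L ∧ des L = β}

/-- `s` is convex in the product order. -/
def Cvx (s : Finset (ℤ × ℤ)) : Prop :=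
  ∀ ⦃i j i' j' x y : ℤ⦄, (i, j) ∈ s → (i', j') ∈ s → i ≤ x → x ≤ i' → j ≤ y → y ≤ j' → (x, y) ∈ s

theorem exists_isLin (s : Finset (ℤ × ℤ)) : ∃ L, IsLin s L := by
  induction s using Finset.induction_on_max_value (fun x : ℤ × ℤ => x.1 + x.2) with
  | empty => exact ⟨[], by simp, List.Pairwise.nil⟩
  | insert a s ha hmax ih =>
    obtain ⟨L, hm, hp⟩ := ih
    refine ⟨L ++ [a], fun x => by simp [hm, or_comm], ?_⟩
    rw [List.pairwise_append]
    refine ⟨hp, List.pairwise_singleton _ _, fun b hb c hc ⟨h1, h2⟩ => ?_⟩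
    obtain rfl : c = a := by simpa using hc
    have hb' := (hm b).1 hb
    have := hmax b hb'
    exact ha (by rwa [show c = b from Prod.ext (by omega) (by omega)])

theorem Bef.ne {a b : ℤ × ℤ} (h : Bef a b) : a ≠ b := by
  rintro rfl; exact h ⟨le_rfl, le_rfl⟩

theorem IsLin.nodup {s L} (h : IsLin s L) : L.Nodup := h.pw.imp Bef.ne

theorem IsLin.length_eq {s L} (h : IsLin s L) : L.length = s.card := by
  rw [← List.toFinset_card_of_nodup h.nodup]
  congr 1; ext x; simp [h.mem]

theorem des_append (l r : List (ℤ × ℤ)) (a b : ℤ × ℤ) :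
    des (l ++ a :: b :: r) = des (l ++ [a]) ++ decide (a.1 < b.1) :: des (b :: r) := by
  induction l with
  | nil => simp [des]
  | cons c l ih => cases l <;> simp_all [des]

theorem des_length (L : List (ℤ × ℤ)) : (des L).length = L.length - 1 := by
  induction L with
  | nil => rfl
  | cons a L ih => cases L <;> simp_all [des]

theorem IsLin.append {s J L R} (hJ : J ⊆ s) (hlow : ∀ x ∈ J, ∀ y ∈ s, y.1 ≤ x.1 → y.2 ≤ x.2 → y ∈ J)
    (hL : IsLin J L) (hR : IsLin (s \ J) R) : IsLin s (L ++ R) := by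
  refine ⟨fun x => ?_, ?_⟩
  · have := @hJ x
    simp only [List.mem_append, hL.mem, hR.mem, Finset.mem_sdiff]; tauto
  · rw [List.pairwise_append]
    refine ⟨hL.pw, hR.pw, fun a ha b hb ⟨h1, h2⟩ => ?_⟩
    have hb' := (hR.mem b).1 hb
    rw [Finset.mem_sdiff] at hb'
    exact hb'.2 (hlow a ((hL.mem a).1 ha) b hb'.1 h1 h2)

/-- Two linear extensions of a lower set with the same descent word and distinct last cells
must be told apart by the cell that follows. -/
theorem MultFree.separates {s J : Finset (ℤ × ℤ)} (h : MultFree s) {P P' : List (ℤ × ℤ)}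
    {e e' : ℤ × ℤ} (hJ : J ⊆ s)
    (hlow : ∀ x ∈ J, ∀ y ∈ s, y.1 ≤ x.1 → y.2 ≤ x.2 → y ∈ J)
    (hP : IsLin J (P ++ [e])) (hP' : IsLin J (P' ++ [e']))
    (hd : des (P ++ [e]) = des (P' ++ [e'])) (hne : e ≠ e') {R : List (ℤ × ℤ)}
    (hR : IsLin (s \ J) R) :
    ∃ b, R.head? = some b ∧ ¬ (e.1 < b.1 ↔ e'.1 < b.1) := by
  have hl : P.length = P'.length := by
    simpa using hP.length_eq.trans hP'.length_eq.symm
  have key : des (P ++ [e] ++ R) ≠ des (P' ++ [e'] ++ R) := by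
    intro hdes
    have h1 := List.append_cancel_right
      (h _ _ (IsLin.append hJ hlow hP hR) (IsLin.append hJ hlow hP' hR) hdes)
    rw [List.append_inj h1 hl |>.2 |> List.cons.inj |>.1] at hne
    exact hne rfl
  cases R with
  | nil => simp [hd] at key
  | cons b R =>
    refine ⟨b, rfl, fun hiff => key ?_⟩
    rw [List.append_assoc, List.append_assoc, List.singleton_append, List.singleton_append,
      des_append, des_append, hd]
    simp [hiff]

theorem Cvx.pred {s} (h : Cvx s) {i j r c : ℤ} (h1 : (i, j) ∈ s) (h2 : (r, c) ∈ s) (hi : i ≤ r)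
    (hj : j ≤ c) : (i = r ∧ j = c) ∨ (i ≤ r - 1 ∧ (r - 1, c) ∈ s) ∨ (j ≤ c - 1 ∧ (r, c - 1) ∈ s) := by
  rcases hi.lt_or_eq with hi' | hi'
  · exact Or.inr (Or.inl ⟨by omega, h h1 h2 (by omega) (by omega) hj le_rfl⟩)
  rcases hj.lt_or_eq with hj' | hj'
  · exact Or.inr (Or.inr ⟨by omega, h h1 h2 hi le_rfl (by omega) (by omega)⟩)
  exact Or.inl ⟨hi', hj'⟩

theorem MultFree.no_two_pairs {s J : Finset (ℤ × ℤ)} (h : MultFree s) {p₁ p₂ p₃ : ℤ × ℤ}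
    {P₁ P₂ Q₁ Q₂ : List (ℤ × ℤ)} (hJ : J ⊆ s)
    (hlow : ∀ x ∈ J, ∀ y ∈ s, y.1 ≤ x.1 → y.2 ≤ x.2 → y ∈ J)
    (h₁₂ : p₁.1 < p₂.1) (h₂₃ : p₂.1 < p₃.1)
    (hP₁ : IsLin J (P₁ ++ [p₂])) (hP₂ : IsLin J (P₂ ++ [p₁]))
    (hQ₁ : IsLin J (Q₁ ++ [p₃])) (hQ₂ : IsLin J (Q₂ ++ [p₂]))
    (hP : des (P₁ ++ [p₂]) = des (P₂ ++ [p₁])) (hQ : des (Q₁ ++ [p₃]) = des (Q₂ ++ [p₂])) :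
    False := by
  obtain ⟨R, hR⟩ := exists_isLin (s \ J)
  obtain ⟨b, hb, hb'⟩ := h.separates hJ hlow hP₁ hP₂ hP (by rintro rfl; simp at h₁₂) hR
  obtain ⟨c, hc, hc'⟩ := h.separates hJ hlow hQ₁ hQ₂ hQ (by rintro rfl; simp at h₂₃) hR
  obtain rfl : b = c := by simpa [hb] using hc
  omega

/-- `r`, `c` are the row and column indices of a three-element antichain of `s`. -/
def IsAnti (s : Finset (ℤ × ℤ)) (p : (ℤ × ℤ) × (ℤ × ℤ) × (ℤ × ℤ)) : Prop :=
  p.1 ∈ s ∧ p.2.1 ∈ s ∧ p.2.2 ∈ s ∧ p.1.1 < p.2.1.1 ∧ p.2.1.1 < p.2.2.1 ∧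
    p.2.2.2 < p.2.1.2 ∧ p.2.1.2 < p.1.2

theorem exists_minimal_anti {s : Finset (ℤ × ℤ)} (h : ∃ p, IsAnti s p) :
    ∃ p, IsAnti s p ∧ ∀ q, IsAnti s q →
      p.1.1 + p.1.2 + p.2.1.1 + p.2.1.2 + p.2.2.1 + p.2.2.2 ≤
        q.1.1 + q.1.2 + q.2.1.1 + q.2.1.2 + q.2.2.1 + q.2.2.2 := by
  classical
  obtain ⟨p, hp⟩ := h
  obtain ⟨m, hm, hmin⟩ := ((s ×ˢ s ×ˢ s).filter (IsAnti s)).exists_min_image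
    (fun p => p.1.1 + p.1.2 + p.2.1.1 + p.2.1.2 + p.2.2.1 + p.2.2.2)
    ⟨p, by simp [hp, hp.1, hp.2.1, hp.2.2.1]⟩
  rw [Finset.mem_filter] at hm
  exact ⟨m, hm.2, fun q hq => hmin q (by simp [hq, hq.1, hq.2.1, hq.2.2.1])⟩

theorem isLin_toFinset {L L' : List (ℤ × ℤ)} (h : ∀ x, x ∈ L' ↔ x ∈ L) (hp : L'.Pairwise Bef) :
    IsLin L.toFinset L' :=
  ⟨fun x => by simp [h], hp⟩

set_option maxHeartbeats 800000 in
theorem MultFree.no_anti {s : Finset (ℤ × ℤ)} (h : MultFree s) (hc : Cvx s) (p) :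
    ¬ IsAnti s p := by
  intro hp
  obtain ⟨⟨⟨r₁, c₁⟩, ⟨r₂, c₂⟩, ⟨r₃, c₃⟩⟩, ⟨h₁, h₂, h₃, hr₁, hr₂, hc₂, hc₁⟩, hmin⟩ :=
    exists_minimal_anti ⟨p, hp⟩
  dsimp only at *
  have U₁ : (r₁ - 1, c₁) ∉ s := fun hm => by
    have := hmin ((r₁ - 1, c₁), (r₂, c₂), (r₃, c₃))
      ⟨hm, h₂, h₃, by dsimp only; omega, hr₂, hc₂, hc₁⟩
    dsimp only at this; omega
  have L₃ : (r₃, c₃ - 1) ∉ s := fun hm => by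
    have := hmin ((r₁, c₁), (r₂, c₂), (r₃, c₃ - 1))
      ⟨h₁, h₂, hm, hr₁, hr₂, by dsimp only; omega, hc₁⟩
    dsimp only at this; omega
  have L₁ : (r₁, c₁ - 1) ∈ s → c₁ - 1 = c₂ := fun hm => by
    by_contra hne
    have := hmin ((r₁, c₁ - 1), (r₂, c₂), (r₃, c₃))
      ⟨hm, h₂, h₃, hr₁, hr₂, hc₂, by dsimp only; omega⟩
    dsimp only at this; omega
  have U₂ : (r₂ - 1, c₂) ∈ s → r₂ - 1 = r₁ := fun hm => by
    by_contra hne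
    have := hmin ((r₁, c₁), (r₂ - 1, c₂), (r₃, c₃))
      ⟨h₁, hm, h₃, by dsimp only; omega, by dsimp only; omega, hc₂, hc₁⟩
    dsimp only at this; omega
  have L₂ : (r₂, c₂ - 1) ∈ s → c₂ - 1 = c₃ := fun hm => by
    by_contra hne
    have := hmin ((r₁, c₁), (r₂, c₂ - 1), (r₃, c₃))
      ⟨h₁, hm, h₃, hr₁, hr₂, by dsimp only; omega, by dsimp only; omega⟩
    dsimp only at this; omega
  have U₃ : (r₃ - 1, c₃) ∈ s → r₃ - 1 = r₂ := fun hm => by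
    by_contra hne
    have := hmin ((r₁, c₁), (r₂, c₂), (r₃ - 1, c₃))
      ⟨h₁, h₂, hm, hr₁, by dsimp only; omega, hc₂, hc₁⟩
    dsimp only at this; omega
  have X : (r₁, c₂) ∈ s → c₁ - 1 = c₂ ∧ r₂ - 1 = r₁ := fun hm =>
    ⟨L₁ (hc hm h₁ le_rfl le_rfl (by omega) (by omega)),
      U₂ (hc hm h₂ (by omega) (by omega) le_rfl le_rfl)⟩
  have Y : (r₂, c₃) ∈ s → c₂ - 1 = c₃ ∧ r₃ - 1 = r₂ := fun hm =>
    ⟨L₂ (hc hm h₂ le_rfl le_rfl (by omega) (by omega)),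
      U₃ (hc hm h₃ (by omega) (by omega) le_rfl le_rfl)⟩
  have L₁' : (r₁, c₁ - 1) ∈ s → (r₁, c₂) ∈ s := fun hm => L₁ hm ▸ hm
  have U₂' : (r₂ - 1, c₂) ∈ s → (r₁, c₂) ∈ s := fun hm => U₂ hm ▸ hm
  have L₂' : (r₂, c₂ - 1) ∈ s → (r₂, c₃) ∈ s := fun hm => L₂ hm ▸ hm
  have U₃' : (r₃ - 1, c₃) ∈ s → (r₂, c₃) ∈ s := fun hm => U₃ hm ▸ hm
  have Xu : (r₁ - 1, c₂) ∉ s := fun hm =>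
    U₁ (hc hm h₁ le_rfl (by omega) (by omega) le_rfl)
  have Xl : (r₁, c₂ - 1) ∈ s → (r₂, c₃) ∈ s := fun hm =>
    L₂' (hc hm h₂ (by omega) le_rfl le_rfl (by omega))
  have Yl : (r₂, c₃ - 1) ∉ s := fun hm =>
    L₃ (hc hm h₃ (by omega) le_rfl le_rfl (by omega))
  have Yu : (r₂ - 1, c₃) ∈ s → (r₁, c₂) ∈ s := fun hm =>
    U₂' (hc hm h₂ le_rfl (by omega) (by omega) le_rfl)
  have Zu : (r₁ - 1, c₃) ∉ s := fun hm =>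
    U₁ (hc hm h₁ le_rfl (by omega) (by omega) le_rfl)
  have Zl : (r₁, c₃ - 1) ∉ s := fun hm =>
    L₃ (hc hm h₃ (by omega) le_rfl le_rfl (by omega))
  have lowP₁ : ∀ i j, (i, j) ∈ s → i ≤ r₁ → j ≤ c₁ →
      (i = r₁ ∧ j = c₁) ∨ ((r₁, c₂) ∈ s ∧ i ≤ r₁ ∧ j ≤ c₂) := fun i j hm hi hj => by
    rcases hc.pred hm h₁ hi hj with h | ⟨-, h⟩ | ⟨h', h⟩
    · exact Or.inl h
    · exact absurd h U₁
    · exact Or.inr ⟨L₁' h, hi, by have := L₁ h; omega⟩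
  have lowP₂ : ∀ i j, (i, j) ∈ s → i ≤ r₂ → j ≤ c₂ → (i = r₂ ∧ j = c₂) ∨
      ((r₁, c₂) ∈ s ∧ i ≤ r₁ ∧ j ≤ c₂) ∨ ((r₂, c₃) ∈ s ∧ i ≤ r₂ ∧ j ≤ c₃) :=
      fun i j hm hi hj => by
    rcases hc.pred hm h₂ hi hj with h | ⟨h', h⟩ | ⟨h', h⟩
    · exact Or.inl h
    · exact Or.inr (Or.inl ⟨U₂' h, by have := U₂ h; omega, hj⟩)
    · exact Or.inr (Or.inr ⟨L₂' h, hi, by have := L₂ h; omega⟩)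
  have lowP₃ : ∀ i j, (i, j) ∈ s → i ≤ r₃ → j ≤ c₃ →
      (i = r₃ ∧ j = c₃) ∨ ((r₂, c₃) ∈ s ∧ i ≤ r₂ ∧ j ≤ c₃) := fun i j hm hi hj => by
    rcases hc.pred hm h₃ hi hj with h | ⟨h', h⟩ | ⟨-, h⟩
    · exact Or.inl h
    · exact Or.inr ⟨U₃' h, by have := U₃ h; omega, hj⟩
    · exact absurd h L₃
  have lowX : (r₁, c₂) ∈ s → ∀ i j, (i, j) ∈ s → i ≤ r₁ → j ≤ c₂ → (i = r₁ ∧ j = c₂) ∨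
      ((r₂, c₃) ∈ s ∧ (r₁, c₃) ∈ s ∧ i ≤ r₁ ∧ j ≤ c₃) := fun hX i j hm hi hj => by
    rcases hc.pred hm hX hi hj with h | ⟨-, h⟩ | ⟨h', h⟩
    · exact Or.inl h
    · exact absurd h Xu
    · have := (Y (Xl h)).1
      exact Or.inr ⟨Xl h, this ▸ h, hi, by omega⟩
  have lowY : (r₂, c₃) ∈ s → ∀ i j, (i, j) ∈ s → i ≤ r₂ → j ≤ c₃ → (i = r₂ ∧ j = c₃) ∨
      ((r₁, c₂) ∈ s ∧ (r₁, c₃) ∈ s ∧ i ≤ r₁ ∧ j ≤ c₃) := fun hY i j hm hi hj => by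
    rcases hc.pred hm hY hi hj with h | ⟨h', h⟩ | ⟨-, h⟩
    · exact Or.inl h
    · have := (X (Yu h)).2
      exact Or.inr ⟨Yu h, this ▸ h, by omega, hj⟩
    · exact absurd h Yl
  have lowZ : (r₁, c₃) ∈ s → ∀ i j, (i, j) ∈ s → i ≤ r₁ → j ≤ c₃ → i = r₁ ∧ j = c₃ :=
      fun hZ i j hm hi hj => by
    rcases hc.pred hm hZ hi hj with h | ⟨-, h⟩ | ⟨-, h⟩
    · exact h
    · exact absurd h Zu
    · exact absurd h Zl
  clear U₁ L₁ L₂ L₃ U₂ U₃ L₁' L₂' U₂' U₃' Xu Xl Yl Yu Zu Zl hmin hc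
  by_cases hX : (r₁, c₂) ∈ s <;> by_cases hY : (r₂, c₃) ∈ s
  · have hXY := X hX
    have hYX := Y hY
    by_cases hZ : (r₁, c₃) ∈ s
    · refine h.no_two_pairs (p₁ := (r₁, c₁)) (p₂ := (r₂, c₂)) (p₃ := (r₃, c₃))
        (J := [(r₁, c₃), (r₁, c₂), (r₂, c₃), (r₁, c₁), (r₂, c₂), (r₃, c₃)].toFinset)
        (P₁ := [(r₁, c₃), (r₁, c₂), (r₂, c₃), (r₁, c₁), (r₃, c₃)])
        (P₂ := [(r₁, c₃), (r₁, c₂), (r₂, c₃), (r₂, c₂), (r₃, c₃)])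
        (Q₁ := [(r₁, c₃), (r₂, c₃), (r₁, c₂), (r₂, c₂), (r₁, c₁)])
        (Q₂ := [(r₁, c₃), (r₂, c₃), (r₁, c₂), (r₃, c₃), (r₁, c₁)])
        ?_ ?_ hr₁ hr₂ (isLin_toFinset ?_ ?_) (isLin_toFinset ?_ ?_) (isLin_toFinset ?_ ?_)
        (isLin_toFinset ?_ ?_) ?_ ?_
      · simp [Finset.insert_subset_iff, h₁, h₂, h₃, hX, hY, hZ]
      · rintro ⟨a, b⟩ hx ⟨i, j⟩ hy hi hj
        simp only [List.mem_toFinset, List.mem_cons, List.not_mem_nil, or_false, Prod.mk.injEq] at hx ⊢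
        grind
      iterate 4
        · intro x; simp only [List.mem_cons, List.mem_append, List.not_mem_nil, or_false]; exact iff_of_eq (by ac_rfl)
        · simp only [List.cons_append, List.nil_append, List.pairwise_cons, List.mem_cons,
            List.not_mem_nil, or_false, forall_eq_or_imp, forall_eq, Bef]
          simp; omega
      all_goals simp [des]; omega
    · refine h.no_two_pairs (p₁ := (r₁, c₁)) (p₂ := (r₂, c₂)) (p₃ := (r₃, c₃))
        (J := [(r₁, c₂), (r₂, c₃), (r₁, c₁), (r₂, c₂), (r₃, c₃)].toFinset)
        (P₁ := [(r₁, c₂), (r₂, c₃), (r₁, c₁), (r₃, c₃)])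
        (P₂ := [(r₁, c₂), (r₂, c₃), (r₂, c₂), (r₃, c₃)])
        (Q₁ := [(r₂, c₃), (r₁, c₂), (r₂, c₂), (r₁, c₁)])
        (Q₂ := [(r₂, c₃), (r₁, c₂), (r₃, c₃), (r₁, c₁)])
        ?_ ?_ hr₁ hr₂ (isLin_toFinset ?_ ?_) (isLin_toFinset ?_ ?_) (isLin_toFinset ?_ ?_)
        (isLin_toFinset ?_ ?_) ?_ ?_
      · simp [Finset.insert_subset_iff, h₁, h₂, h₃, hX, hY]
      · rintro ⟨a, b⟩ hx ⟨i, j⟩ hy hi hj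
        simp only [List.mem_toFinset, List.mem_cons, List.not_mem_nil, or_false, Prod.mk.injEq] at hx ⊢
        grind
      iterate 4
        · intro x; simp only [List.mem_cons, List.mem_append, List.not_mem_nil, or_false]; exact iff_of_eq (by ac_rfl)
        · simp only [List.cons_append, List.nil_append, List.pairwise_cons, List.mem_cons,
            List.not_mem_nil, or_false, forall_eq_or_imp, forall_eq, Bef]
          simp; omega
      all_goals simp [des]; omega
  · have hXY := X hX
    refine h.no_two_pairs (p₁ := (r₁, c₁)) (p₂ := (r₂, c₂)) (p₃ := (r₃, c₃))
      (J := [(r₁, c₂), (r₁, c₁), (r₂, c₂), (r₃, c₃)].toFinset)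
      (P₁ := [(r₁, c₂), (r₁, c₁), (r₃, c₃)]) (P₂ := [(r₃, c₃), (r₁, c₂), (r₂, c₂)])
      (Q₁ := [(r₁, c₂), (r₂, c₂), (r₁, c₁)]) (Q₂ := [(r₁, c₂), (r₃, c₃), (r₁, c₁)])
      ?_ ?_ hr₁ hr₂ (isLin_toFinset ?_ ?_) (isLin_toFinset ?_ ?_) (isLin_toFinset ?_ ?_)
      (isLin_toFinset ?_ ?_) ?_ ?_
    · simp [Finset.insert_subset_iff, h₁, h₂, h₃, hX]
    · rintro ⟨a, b⟩ hx ⟨i, j⟩ hy hi hj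
      simp only [List.mem_toFinset, List.mem_cons, List.not_mem_nil, or_false, Prod.mk.injEq] at hx ⊢
      grind
    iterate 4
      · intro x; simp only [List.mem_cons, List.mem_append, List.not_mem_nil, or_false]; exact iff_of_eq (by ac_rfl)
      · simp only [List.cons_append, List.nil_append, List.pairwise_cons, List.mem_cons,
          List.not_mem_nil, or_false, forall_eq_or_imp, forall_eq, Bef]
        simp; omega
    all_goals simp [des]; omega
  · have hYX := Y hY
    refine h.no_two_pairs (p₁ := (r₁, c₁)) (p₂ := (r₂, c₂)) (p₃ := (r₃, c₃))
      (J := [(r₂, c₃), (r₁, c₁), (r₂, c₂), (r₃, c₃)].toFinset)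
      (P₁ := [(r₂, c₃), (r₁, c₁), (r₃, c₃)]) (P₂ := [(r₂, c₃), (r₂, c₂), (r₃, c₃)])
      (Q₁ := [(r₁, c₁), (r₂, c₃), (r₂, c₂)]) (Q₂ := [(r₂, c₃), (r₃, c₃), (r₁, c₁)])
      ?_ ?_ hr₁ hr₂ (isLin_toFinset ?_ ?_) (isLin_toFinset ?_ ?_) (isLin_toFinset ?_ ?_)
      (isLin_toFinset ?_ ?_) ?_ ?_
    · simp [Finset.insert_subset_iff, h₁, h₂, h₃, hY]
    · rintro ⟨a, b⟩ hx ⟨i, j⟩ hy hi hj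
      simp only [List.mem_toFinset, List.mem_cons, List.not_mem_nil, or_false, Prod.mk.injEq] at hx ⊢
      grind
    iterate 4
      · intro x; simp only [List.mem_cons, List.mem_append, List.not_mem_nil, or_false]; exact iff_of_eq (by ac_rfl)
      · simp only [List.cons_append, List.nil_append, List.pairwise_cons, List.mem_cons,
          List.not_mem_nil, or_false, forall_eq_or_imp, forall_eq, Bef]
        simp; omega
    all_goals simp [des]; omega
  · refine h.no_two_pairs (p₁ := (r₁, c₁)) (p₂ := (r₂, c₂)) (p₃ := (r₃, c₃))
      (J := [(r₁, c₁), (r₂, c₂), (r₃, c₃)].toFinset)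
      (P₁ := [(r₁, c₁), (r₃, c₃)]) (P₂ := [(r₂, c₂), (r₃, c₃)])
      (Q₁ := [(r₂, c₂), (r₁, c₁)]) (Q₂ := [(r₃, c₃), (r₁, c₁)])
      ?_ ?_ hr₁ hr₂ (isLin_toFinset ?_ ?_) (isLin_toFinset ?_ ?_) (isLin_toFinset ?_ ?_)
      (isLin_toFinset ?_ ?_) ?_ ?_
    · simp [Finset.insert_subset_iff, h₁, h₂, h₃]
    · rintro ⟨a, b⟩ hx ⟨i, j⟩ hy hi hj
      simp only [List.mem_toFinset, List.mem_cons, List.not_mem_nil, or_false, Prod.mk.injEq] at hx ⊢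
      grind
    iterate 4
      · intro x; simp only [List.mem_cons, List.mem_append, List.not_mem_nil, or_false]; exact iff_of_eq (by ac_rfl)
      · simp only [List.cons_append, List.nil_append, List.pairwise_cons, List.mem_cons,
          List.not_mem_nil, or_false, forall_eq_or_imp, forall_eq, Bef]
        simp; omega
    all_goals simp [des]; omega

/-- The transpose of a set of cells. -/
def transpose (s : Finset (ℤ × ℤ)) : Finset (ℤ × ℤ) := s.image Prod.swap

/-- The half-turn of a set of cells. -/
def halfTurn (s : Finset (ℤ × ℤ)) : Finset (ℤ × ℤ) := s.image Neg.neg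

@[simp] theorem mem_transpose {s : Finset (ℤ × ℤ)} {x : ℤ × ℤ} : x ∈ transpose s ↔ (x.2, x.1) ∈ s := by
  constructor
  · intro h
    obtain ⟨y, hy, rfl⟩ := Finset.mem_image.1 h
    exact hy
  · intro h
    exact Finset.mem_image.2 ⟨_, h, rfl⟩

@[simp] theorem mem_halfTurn {s : Finset (ℤ × ℤ)} {x : ℤ × ℤ} : x ∈ halfTurn s ↔ (-x.1, -x.2) ∈ s := by
  constructor
  · intro h
    obtain ⟨y, hy, rfl⟩ := Finset.mem_image.1 h
    simpa using hy
  · intro h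
    exact Finset.mem_image.2 ⟨_, h, by simp⟩

@[simp] theorem transpose_transpose (s : Finset (ℤ × ℤ)) : transpose (transpose s) = s := by ext x; simp

@[simp] theorem halfTurn_halfTurn (s : Finset (ℤ × ℤ)) : halfTurn (halfTurn s) = s := by ext x; simp

theorem card_transpose (s : Finset (ℤ × ℤ)) : (transpose s).card = s.card :=
  Finset.card_image_of_injective _ Prod.swap_injective

theorem card_halfTurn (s : Finset (ℤ × ℤ)) : (halfTurn s).card = s.card :=
  Finset.card_image_of_injective _ neg_injective

theorem Cvx.tr {s : Finset (ℤ × ℤ)} (h : Cvx s) : Cvx (transpose s) := by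
  intro i j i' j' x y h1 h2 h3 h4 h5 h6
  simp only [mem_transpose] at *
  exact h h1 h2 h5 h6 h3 h4

theorem Cvx.ng {s : Finset (ℤ × ℤ)} (h : Cvx s) : Cvx (halfTurn s) := by
  intro i j i' j' x y h1 h2 h3 h4 h5 h6
  simp only [mem_halfTurn] at *
  exact h h2 h1 (by omega) (by omega) (by omega) (by omega)

theorem IsLin.tr {s : Finset (ℤ × ℤ)} {L} (h : IsLin s L) : IsLin (transpose s) (L.map Prod.swap) := by
  refine ⟨fun x => ?_, ?_⟩
  · rw [mem_transpose, ← h.mem]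
    constructor
    · intro hx
      obtain ⟨y, hy, rfl⟩ := List.mem_map.1 hx
      exact hy
    · intro hx
      exact List.mem_map.2 ⟨_, hx, rfl⟩
  · rw [List.pairwise_map]
    exact h.pw.imp fun hab ⟨h1, h2⟩ => hab ⟨h2, h1⟩

theorem IsLin.ng {s : Finset (ℤ × ℤ)} {L} (h : IsLin s L) :
    IsLin (halfTurn s) (L.map Neg.neg).reverse := by
  refine ⟨fun x => ?_, ?_⟩
  · rw [mem_halfTurn, ← h.mem, List.mem_reverse]
    constructor
    · intro hx
      obtain ⟨y, hy, rfl⟩ := List.mem_map.1 hx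
      simpa using hy
    · intro hx
      exact List.mem_map.2 ⟨_, hx, by simp⟩
  · rw [List.pairwise_reverse, List.pairwise_map]
    refine h.pw.imp fun {a b} hab ⟨h1, h2⟩ => hab ?_
    simp only [Prod.fst_neg, Prod.snd_neg] at h1 h2
    exact ⟨by omega, by omega⟩

theorem IsLin.consec {s : Finset (ℤ × ℤ)} (hc : Cvx s) {l r a b} (h : IsLin s (l ++ a :: b :: r)) :
    a.2 < b.2 ↔ ¬ a.1 < b.1 := by
  have hp := h.pw
  have hm := h.mem (a.1, b.2)
  have ha := (h.mem a).1 (by simp)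
  have hb := (h.mem b).1 (by simp)
  simp only [List.pairwise_append, List.pairwise_cons, List.mem_cons, List.mem_append] at hp hm
  obtain ⟨_, ⟨h1, h2, _⟩, h3⟩ := hp
  have hab := h1 b (Or.inl rfl)
  constructor
  · intro h4 h5
    have hm' := hm.2 (hc (i := a.1) (j := a.2) (i' := b.1) (j' := b.2) ha hb le_rfl h5.le h4.le le_rfl)
    rcases hm' with hm' | hm' | hm' | hm'
    · exact h3 _ hm' a (Or.inl rfl) ⟨le_rfl, h4.le⟩
    · have := congrArg Prod.snd hm'; dsimp only at this; omega
    · have := congrArg Prod.fst hm'; dsimp only at this; omega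
    · exact h2 _ hm' ⟨h5.le, le_rfl⟩
  · intro h4
    by_contra h5
    exact hab ⟨by omega, by omega⟩

theorem des_map_swap {s : Finset (ℤ × ℤ)} (hc : Cvx s) (r : List (ℤ × ℤ)) :
    ∀ l, IsLin s (l ++ r) → des (r.map Prod.swap) = (des r).map not := by
  induction r with
  | nil => intros; rfl
  | cons a r ih =>
    intro l h
    cases r with
    | nil => rfl
    | cons b r =>
      have h1 := ih (l ++ [a]) (by simpa using h)
      simp only [List.map_cons, des] at h1 ⊢
      rw [h1]
      congr 1
      have := IsLin.consec hc h
      simp only [Prod.fst_swap, this, decide_not]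

theorem des_reverse_neg (L : List (ℤ × ℤ)) : des (L.map Neg.neg).reverse = (des L).reverse := by
  induction L with
  | nil => rfl
  | cons a L ih =>
    cases L with
    | nil => rfl
    | cons b L =>
      simp only [List.map_cons, List.reverse_cons, List.append_assoc, des] at ih ⊢
      rw [← ih]
      have := des_append (L.map Neg.neg).reverse [] (-b) (-a)
      simp only [List.singleton_append]
      rw [this]
      simp [des]

theorem supp_transpose {s : Finset (ℤ × ℤ)} (hc : Cvx s) {β : List Bool} :
    β ∈ Supp (transpose s) ↔ β.map not ∈ Supp s := by
  constructor
  · rintro ⟨L, hL, rfl⟩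
    exact ⟨_, by simpa using hL.tr, des_map_swap hc.tr L [] hL⟩
  · rintro ⟨L, hL, hd⟩
    refine ⟨_, hL.tr, ?_⟩
    rw [des_map_swap hc L [] hL, hd, List.map_map]
    convert List.map_id β using 2
    ext b; cases b <;> rfl

theorem supp_halfTurn {s : Finset (ℤ × ℤ)} {β : List Bool} :
    β ∈ Supp (halfTurn s) ↔ β.reverse ∈ Supp s := by
  constructor
  · rintro ⟨L, hL, rfl⟩
    exact ⟨_, by simpa using hL.ng, des_reverse_neg L⟩
  · rintro ⟨L, hL, hd⟩
    exact ⟨_, hL.ng, by rw [des_reverse_neg, hd, List.reverse_reverse]⟩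

theorem MultFree.tr {s : Finset (ℤ × ℤ)} (hc : Cvx s) (h : MultFree s) : MultFree (transpose s) := by
  intro L L' hL hL' hd
  have h1 := h (L.map Prod.swap) (L'.map Prod.swap) (by simpa using hL.tr) (by simpa using hL'.tr)
    (by rw [des_map_swap hc.tr L [] hL, des_map_swap hc.tr L' [] hL', hd])
  exact (List.map_injective_iff.2 Prod.swap_injective) h1

theorem des_of_antitone {L : List (ℤ × ℤ)} (h : L.Pairwise fun a b => b.1 ≤ a.1) :
    des L = List.replicate (L.length - 1) false := by
  induction L with
  | nil => rfl
  | cons a L ih =>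
    cases L with
    | nil => rfl
    | cons b L =>
      have h1 := List.pairwise_cons.1 h
      have h2 := ih h1.2
      have h3 := h1.1 b (by simp)
      simp only [des, h2, List.length_cons, Nat.add_sub_cancel, List.replicate_succ]
      simp [h3]

theorem des_of_antitone_append {X Y : List (ℤ × ℤ)} {e f : ℤ × ℤ}
    (hX : (X ++ [e]).Pairwise fun a b => b.1 ≤ a.1) (hY : (f :: Y).Pairwise fun a b => b.1 ≤ a.1)
    (h : e.1 < f.1) :
    des (X ++ [e] ++ f :: Y) = List.replicate X.length false ++ true :: List.replicate Y.length false := by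
  rw [List.append_assoc, List.singleton_append, des_append, des_of_antitone hX, des_of_antitone hY]
  simp [h]

theorem antitone_of_rows {A B : List (ℤ × ℤ)} {u v : ℤ} (huv : u ≤ v) (hA : ∀ x ∈ A, x.1 = v)
    (hB : ∀ x ∈ B, x.1 = u) : (A ++ B).Pairwise fun a b => b.1 ≤ a.1 := by
  rw [List.pairwise_append]
  refine ⟨?_, ?_, ?_⟩
  · exact List.pairwise_of_forall_mem_list (fun a ha b hb => by rw [hA a ha, hA b hb])
  · exact List.pairwise_of_forall_mem_list (fun a ha b hb => by rw [hB a ha, hB b hb])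
  · intro a ha b hb
    rw [hA a ha, hB b hb]
    exact huv

/-- Two rows that can be interleaved in two ways with the same descent word. -/
theorem MultFree.two_row {s : Finset (ℤ × ℤ)} (hs : MultFree s) {u v p q : ℤ} (huv : u < v)
    (hrow : ∀ x ∈ s, x.1 = u ∨ x.1 = v) (hx : (v, p) ∈ s) (hy : (u, q) ∈ s)
    (hp : ∀ c, (u, c) ∈ s → p < c) (hq : ∀ c, (v, c) ∈ s → c < q)
    (hN : ∃ c, p < c ∧ (v, c) ∈ s) (hM : ∃ c, c < q ∧ (u, c) ∈ s) (hmax : ∀ c, (u, c) ∈ s → c ≤ q) : False := by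
  obtain ⟨P, hPm, hP⟩ := exists_isLin (s.filter fun x => x.1 = v ∧ x.2 < p)
  obtain ⟨N, hNm, hNp⟩ := exists_isLin (s.filter fun x => x.1 = v ∧ p < x.2)
  obtain ⟨M, hMm, hMp⟩ := exists_isLin (s.filter fun x => x.1 = u ∧ x.2 < q)
  simp only [Finset.mem_filter] at hPm hNm hMm
  have hNe : N ≠ [] := by
    obtain ⟨c, h1, h2⟩ := hN
    exact List.ne_nil_of_mem ((hNm (v, c)).2 ⟨h2, rfl, h1⟩)
  have hMe : M ≠ [] := by
    obtain ⟨c, h1, h2⟩ := hM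
    exact List.ne_nil_of_mem ((hMm (u, c)).2 ⟨h2, rfl, h1⟩)
  have hp' : ∀ x ∈ s, x.1 = u → p < x.2 := by
    rintro ⟨a, b⟩ h1 rfl; exact hp _ h1
  have hq' : ∀ x ∈ s, x.1 = v → x.2 < q := by
    rintro ⟨a, b⟩ h1 rfl; exact hq _ h1
  have hpq := hq _ hx
  have h1 : IsLin s (P ++ [(v, p)] ++ M ++ (N ++ [(u, q)])) := by
    refine ⟨fun x => ?_, ?_⟩
    · simp only [List.mem_append, hPm, hMm, hNm, List.mem_singleton]
      rcases x with ⟨a, b⟩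
      have := hrow (a, b)
      have := hmax b
      grind
    · simp only [List.pairwise_append, List.mem_append, hPm, hMm, hNm, List.mem_singleton, Bef,
        List.pairwise_singleton]
      refine ⟨⟨⟨hP, trivial, ?_⟩, hMp, ?_⟩, ⟨hNp, trivial, ?_⟩, ?_⟩ <;> grind
  have h2 : IsLin s (P ++ M ++ [(u, q)] ++ ((v, p) :: N)) := by
    refine ⟨fun x => ?_, ?_⟩
    · simp only [List.mem_append, hPm, hMm, hNm, List.mem_cons, List.not_mem_nil, or_false]
      rcases x with ⟨a, b⟩
      have := hrow (a, b)
      have := hmax b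
      grind
    · simp only [List.pairwise_append, List.mem_append, hPm, hMm, Bef,
        List.pairwise_cons, List.mem_cons]
      refine ⟨⟨⟨hP, hMp, ?_⟩, ⟨by simp, List.Pairwise.nil⟩, ?_⟩, ⟨?_, hNp⟩, ?_⟩ <;> grind
  obtain ⟨n, N', rfl⟩ := List.exists_cons_of_ne_nil hNe
  have hn := (hNm n).1 (by simp)
  have hd : des (P ++ [(v, p)] ++ M ++ (n :: N' ++ [(u, q)])) =
      des (P ++ M ++ [(u, q)] ++ ((v, p) :: n :: N')) := by
    obtain ⟨M', m, rfl⟩ := List.eq_nil_or_concat' M |>.resolve_left hMe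
    have hm := (hMm m).1 (by simp)
    rw [des_of_antitone_append (X := P ++ (M' ++ [m])) (e := (u, q)), List.cons_append,
      ← List.append_assoc, des_of_antitone_append (X := P ++ [(v, p)] ++ M') (e := m)]
    · simp
    · simpa using antitone_of_rows huv.le (A := P ++ [(v, p)]) (B := M' ++ [m]) (by grind) (by grind)
    · simpa using antitone_of_rows huv.le (A := n :: N') (B := [(u, q)]) (by grind) (by grind)
    · exact hm.2.1.trans_lt (huv.trans_eq hn.2.1.symm)
    · simpa using antitone_of_rows huv.le (A := P) (B := M' ++ [m] ++ [(u, q)])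
        (by grind) (by grind)
    · simpa using antitone_of_rows huv.le (A := (v, p) :: n :: N') (B := []) (by grind) (by grind)
    · exact huv
  have h3 := hs _ _ h1 h2 hd
  obtain ⟨m, M', rfl⟩ := List.exists_cons_of_ne_nil hMe
  have hm := (hMm m).1 (by simp)
  simp only [List.append_assoc, List.append_cancel_left_eq, List.cons_append,
    List.cons.injEq] at h3
  have := hm.2.1
  rw [← h3.1] at this
  dsimp only at this
  omega

theorem Cvx.row {s : Finset (ℤ × ℤ)} (hc : Cvx s) {i j : ℤ} (h : (i, j) ∈ s) :
    ∃ a b, a ≤ b ∧ ∀ c, (i, c) ∈ s ↔ a ≤ c ∧ c ≤ b := by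
  have hj : j ∈ (s.filter fun x => x.1 = i).image Prod.snd :=
    Finset.mem_image.2 ⟨_, Finset.mem_filter.2 ⟨h, rfl⟩, rfl⟩
  set R := (s.filter fun x => x.1 = i).image Prod.snd with hR
  have hm : ∀ c, c ∈ R ↔ (i, c) ∈ s := by
    intro c
    rw [hR, Finset.mem_image]
    constructor
    · rintro ⟨⟨a, b⟩, h1, rfl⟩
      rw [Finset.mem_filter] at h1
      obtain ⟨h1, rfl⟩ := h1
      exact h1
    · exact fun h1 => ⟨_, Finset.mem_filter.2 ⟨h1, rfl⟩, rfl⟩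
  refine ⟨R.min' ⟨j, hj⟩, R.max' ⟨j, hj⟩, R.min'_le_max' _, fun c => ⟨fun h1 => ?_, fun h1 => ?_⟩⟩
  · exact ⟨R.min'_le _ ((hm c).2 h1), R.le_max' _ ((hm c).2 h1)⟩
  · exact hc ((hm _).1 (R.min'_mem ⟨j, hj⟩)) ((hm _).1 (R.max'_mem ⟨j, hj⟩)) le_rfl le_rfl h1.1 h1.2

/-- `s` is covered by one row and one column. -/
def Cross (s : Finset (ℤ × ℤ)) : Prop := ∃ i j, ∀ x ∈ s, x.1 = i ∨ x.2 = j

/-- `s` is the Young diagram of `(a, b)` with first cell `(u, x)`. -/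
def Straight (s : Finset (ℤ × ℤ)) (a b u x : ℤ) : Prop :=
  ∀ i j, (i, j) ∈ s ↔ (i = u ∧ x ≤ j ∧ j < x + a) ∨ (i = u + 1 ∧ x ≤ j ∧ j < x + b)

/-- `s` is the half-turn of the Young diagram of `(a, b)`. -/
def Rotated (s : Finset (ℤ × ℤ)) (a b u x : ℤ) : Prop :=
  ∀ i j, (i, j) ∈ s ↔ (i = u ∧ x + a - b ≤ j ∧ j < x + a) ∨ (i = u + 1 ∧ x ≤ j ∧ j < x + a)

/-- `s` is the Young diagram of `(a, b)` or a half-turn of it. -/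
def TR (s : Finset (ℤ × ℤ)) (a b : ℤ) : Prop :=
  b ≤ a ∧ ∃ u x : ℤ, Straight s a b u x ∨ Rotated s a b u x

theorem MultFree.of_two_rows {s : Finset (ℤ × ℤ)} (hs : MultFree s) (hc : Cvx s) {u v : ℤ}
    (huv : u < v) (hrow : ∀ x ∈ s, x.1 = u ∨ x.1 = v) :
    Cross s ∨ ∃ a b, 2 ≤ b ∧ TR s a b := by
  by_cases hu : ∃ j, (u, j) ∈ s
  swap
  · refine Or.inl ⟨v, 0, fun x hx => Or.inl ((hrow x hx).resolve_left ?_)⟩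
    rintro rfl
    exact hu ⟨x.2, hx⟩
  by_cases hv : ∃ j, (v, j) ∈ s
  swap
  · refine Or.inl ⟨u, 0, fun x hx => Or.inl ((hrow x hx).resolve_right ?_)⟩
    rintro rfl
    exact hv ⟨x.2, hx⟩
  obtain ⟨_, hu⟩ := hu
  obtain ⟨_, hv⟩ := hv
  obtain ⟨a₁, b₁, hab₁, h₁⟩ := hc.row hu
  obtain ⟨a₂, b₂, hab₂, h₂⟩ := hc.row hv
  clear hu hv
  by_cases e₁ : a₁ = b₁
  · refine Or.inl ⟨v, a₁, fun ⟨i, j⟩ hx => ?_⟩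
    rcases hrow _ hx with h | h
    · dsimp only at h; subst h
      have := (h₁ j).1 hx
      exact Or.inr (by dsimp only; omega)
    · exact Or.inl h
  by_cases e₂ : a₂ = b₂
  · refine Or.inl ⟨u, a₂, fun ⟨i, j⟩ hx => ?_⟩
    rcases hrow _ hx with h | h
    · exact Or.inl h
    · dsimp only at h; subst h
      have := (h₂ j).1 hx
      exact Or.inr (by dsimp only; omega)
  have ha₁ := (h₁ a₁).2 ⟨le_rfl, hab₁⟩
  have hb₁ := (h₁ b₁).2 ⟨hab₁, le_rfl⟩
  have ha₂ := (h₂ a₂).2 ⟨le_rfl, hab₂⟩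
  have hb₂ := (h₂ b₂).2 ⟨hab₂, le_rfl⟩
  have hmem : ∀ i j, (i, j) ∈ s ↔ (i = u ∧ a₁ ≤ j ∧ j ≤ b₁) ∨ (i = v ∧ a₂ ≤ j ∧ j ≤ b₂) := by
    intro i j
    rw [← h₁, ← h₂]
    constructor
    · intro h
      rcases hrow _ h with h' | h' <;> dsimp only at h' <;> subst h' <;> simp [h]
    · rintro (⟨rfl, h⟩ | ⟨rfl, h⟩) <;> exact h
  have hadj : ∀ j, (u + 1, j) ∈ s → v = u + 1 := fun j h => by
    have := hrow _ h
    dsimp only at this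
    omega
  by_cases hl : a₁ ≤ a₂
  · have e := (h₂ a₁).1 (hc ha₁ ha₂ huv.le le_rfl le_rfl hl)
    have e' := (h₁ b₂).1 (hc ha₁ hb₂ le_rfl huv.le (by omega) le_rfl)
    obtain rfl := hadj a₂ (hc ha₁ ha₂ (by omega) (by omega) hl le_rfl)
    refine Or.inr ⟨b₁ - a₁ + 1, b₂ - a₂ + 1, by omega, by omega, u, a₁, Or.inl fun i j => ?_⟩
    rw [hmem]
    omega
  by_cases hr : b₁ ≤ b₂
  · have e := (h₁ b₂).1 (hc hb₁ hb₂ le_rfl huv.le hr le_rfl)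
    obtain rfl := hadj b₁ (hc hb₁ hb₂ (by omega) (by omega) le_rfl hr)
    refine Or.inr ⟨b₂ - a₂ + 1, b₁ - a₁ + 1, by omega, by omega, u, a₂, Or.inr fun i j => ?_⟩
    rw [hmem]
    omega
  exfalso
  refine hs.two_row huv hrow (p := min (a₁ - 1) (b₂ - 1)) (q := b₁) ((h₂ _).2 (by omega)) hb₁
    (fun c h => ?_) (fun c h => ?_) ⟨b₂, by omega, hb₂⟩ ⟨a₁, by omega, ha₁⟩ (fun c h => ?_)
  · have := (h₁ c).1 h; omega
  · have := (h₂ c).1 h; omega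
  · exact ((h₁ c).1 h).2

/-- A set of cells with no three non-attacking rooks is covered by two lines. -/
theorem covered_of_no_three_rooks {s : Finset (ℤ × ℤ)}
    (h : ∀ x ∈ s, ∀ y ∈ s, ∀ z ∈ s, x.1 ≠ y.1 → x.1 ≠ z.1 → y.1 ≠ z.1 → x.2 ≠ y.2 → x.2 ≠ z.2 →
      y.2 = z.2) :
    (∃ u v, ∀ x ∈ s, x.1 = u ∨ x.1 = v) ∨ (∃ u v, ∀ x ∈ s, x.2 = u ∨ x.2 = v) ∨ Cross s := by
  by_cases hp : ∃ p ∈ s, ∃ q ∈ s, p.1 ≠ q.1 ∧ p.2 ≠ q.2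
  swap
  · push Not at hp
    rcases s.eq_empty_or_nonempty with rfl | ⟨p, hps⟩
    · exact Or.inl ⟨0, 0, by simp⟩
    · refine Or.inr (Or.inr ⟨p.1, p.2, fun x hx => ?_⟩)
      have := hp p hps x hx
      omega
  obtain ⟨⟨i, j⟩, hp, ⟨i', j'⟩, hq, hi, hj⟩ := hp
  dsimp only at hi hj
  by_contra! hcon
  unfold Cross at hcon
  push Not at hcon
  obtain ⟨H1, H2, H3⟩ := hcon
  obtain ⟨⟨r1, c1⟩, h1, h1a, h1b⟩ := H1 i i'
  obtain ⟨⟨r2, c2⟩, h2, h2a, h2b⟩ := H2 j j'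
  obtain ⟨⟨r3, c3⟩, h3, h3a, h3b⟩ := H3 i j'
  obtain ⟨⟨r4, c4⟩, h4, h4a, h4b⟩ := H3 i' j
  dsimp only at *
  clear H1 H2 H3
  have k12 := fun x hx => h _ h1 _ h2 x hx
  have k13 := fun x hx => h _ h1 _ h3 x hx
  have k14 := fun x hx => h _ h1 _ h4 x hx
  have k23 := fun x hx => h _ h2 _ h3 x hx
  have k24 := fun x hx => h _ h2 _ h4 x hx
  have kpq := fun x hx => h _ hp _ hq x hx
  have e1 := kpq _ h1
  have e2 := kpq _ h2
  have e3 := kpq _ h3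
  have e4 := kpq _ h4
  have e5 := k12 _ hp
  have e6 := k12 _ hq
  have e7 := k12 _ h3
  have e8 := k12 _ h4
  have e9 := k13 _ hp
  have e10 := k13 _ hq
  have e11 := k14 _ hp
  have e12 := k14 _ hq
  have e13 := k23 _ hp
  have e14 := k23 _ hq
  have e15 := k24 _ hp
  have e16 := k24 _ hq
  clear h k12 k13 k14 k23 k24 kpq h1 h2 h3 h4 hp hq
  dsimp only at *
  grind

/-- `s` contains a `2 × 2` square. -/
def Has22 (s : Finset (ℤ × ℤ)) : Prop :=
  ∃ i j, (i, j) ∈ s ∧ (i, j + 1) ∈ s ∧ (i + 1, j) ∈ s ∧ (i + 1, j + 1) ∈ s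

theorem Cvx.has22 {s : Finset (ℤ × ℤ)} (hc : Cvx s) {a b : ℤ × ℤ} (ha : a ∈ s) (hb : b ∈ s)
    (h1 : a.1 < b.1) (h2 : a.2 < b.2) : Has22 s :=
  ⟨a.1, a.2, ha, hc (i := a.1) (j := a.2) ha hb le_rfl h1.le (by omega) (by omega),
    hc (i := a.1) (j := a.2) ha hb (by omega) (by omega) le_rfl h2.le,
    hc (i := a.1) (j := a.2) ha hb (by omega) (by omega) (by omega) (by omega)⟩

theorem covered_of_has22 {s : Finset (ℤ × ℤ)} (hc : Cvx s) (h : Has22 s)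
    (hn : ∀ p, ¬ IsAnti s p) :
    (∃ u v, ∀ x ∈ s, x.1 = u ∨ x.1 = v) ∨ (∃ u v, ∀ x ∈ s, x.2 = u ∨ x.2 = v) := by
  obtain ⟨i, j, h00, h01, h10, h11⟩ := h
  have anti : ∀ a b c : ℤ × ℤ, a ∈ s → b ∈ s → c ∈ s → a.1 < b.1 → b.1 < c.1 → c.2 < b.2 →
      b.2 < a.2 → False := fun a b c h1 h2 h3 h4 h5 h6 h7 => hn (a, b, c) ⟨h1, h2, h3, h4, h5, h6, h7⟩
  by_contra! hcon
  obtain ⟨H1, H2⟩ := hcon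
  obtain ⟨⟨r, c⟩, hx, hr, hr'⟩ := H1 i (i + 1)
  obtain ⟨⟨r', c'⟩, hy, hc1, hc2⟩ := H2 j (j + 1)
  clear H1 H2
  dsimp only at *
  have hv : (i + 2, j) ∈ s ∨ (i - 1, j + 1) ∈ s := by
    rcases lt_or_ge r i with h | h
    · right
      rcases le_or_gt c (j + 1) with h' | h'
      · exact hc hx h01 (by omega) (by omega) h' le_rfl
      · exact (anti _ _ _ hx h01 h10 (by grind) (by grind) (by grind) (by grind)).elim
    · left
      rcases le_or_gt j c with h' | h'
      · exact hc h10 hx (by omega) (by omega) le_rfl h'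
      · exact (anti _ _ _ h01 h10 hx (by grind) (by grind) (by grind) (by grind)).elim
  have hh : (i, j + 2) ∈ s ∨ (i + 1, j - 1) ∈ s := by
    rcases lt_or_ge c' j with h | h
    · right
      rcases le_or_gt r' (i + 1) with h' | h'
      · exact hc hy h10 h' le_rfl (by omega) (by omega)
      · exact (anti _ _ _ h01 h10 hy (by grind) (by grind) (by grind) (by grind)).elim
    · left
      rcases le_or_gt i r' with h' | h'
      · exact hc h01 hy le_rfl h' (by omega) (by omega)
      · exact (anti _ _ _ hy h01 h10 (by grind) (by grind) (by grind) (by grind)).elim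
  rcases hv with hv | hv <;> rcases hh with hh | hh
  · exact anti _ _ _ hh h11 hv (by grind) (by grind) (by grind) (by grind)
  · exact anti _ _ _ h01 h10 (hc hh hv (i := i + 1) (j := j - 1) (x := i + 2) (y := j - 1)
      (by omega) le_rfl le_rfl (by omega)) (by grind) (by grind) (by grind) (by grind)
  · exact anti _ _ _ (hc hv hh (x := i - 1) (y := j + 2) (by omega) (by omega) (by omega) (by omega))
      h01 h10 (by grind) (by grind) (by grind) (by grind)
  · exact anti _ _ _ hv h00 hh (by grind) (by grind) (by grind) (by grind)

theorem Cross.tr {s : Finset (ℤ × ℤ)} (h : Cross s) : Cross (transpose s) := by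
  obtain ⟨i, j, h⟩ := h
  exact ⟨j, i, fun x hx => (h _ (mem_transpose.1 hx)).symm⟩

theorem MultFree.classification {s : Finset (ℤ × ℤ)} (hs : MultFree s) (hc : Cvx s) :
    Cross s ∨ ∃ a b, 2 ≤ b ∧ (TR s a b ∨ TR (transpose s) a b) := by
  have hn := hs.no_anti hc
  have rows : ∀ {t : Finset (ℤ × ℤ)}, MultFree t → Cvx t → (∃ u v, ∀ x ∈ t, x.1 = u ∨ x.1 = v) →
      Cross t ∨ ∃ a b, 2 ≤ b ∧ TR t a b := by
    rintro t ht hct ⟨u, v, h⟩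
    rcases lt_trichotomy u v with huv | rfl | huv
    · exact ht.of_two_rows hct huv h
    · exact Or.inl ⟨u, 0, fun x hx => Or.inl (by simpa using h x hx)⟩
    · exact ht.of_two_rows hct huv fun x hx => (h x hx).symm
  have key : (∃ u v, ∀ x ∈ s, x.1 = u ∨ x.1 = v) ∨ (∃ u v, ∀ x ∈ s, x.2 = u ∨ x.2 = v) ∨
      Cross s := by
    by_cases h22 : Has22 s
    · exact (covered_of_has22 hc h22 hn).imp_right Or.inl
    have hlt : ∀ x ∈ s, ∀ y ∈ s, x.1 < y.1 → y.2 ≤ x.2 := fun x hx y hy h1 => by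
      by_contra! h2
      exact h22 (hc.has22 hx hy h1 h2)
    refine covered_of_no_three_rooks fun x hx y hy z hz h1 h2 h3 h4 h5 => by_contra fun h6 => ?_
    have cmp : ∀ x ∈ s, ∀ y ∈ s, x.1 ≠ y.1 → x.2 ≠ y.2 →
        (x.1 < y.1 ∧ y.2 < x.2) ∨ (y.1 < x.1 ∧ x.2 < y.2) := fun x hx y hy h1 h2 => by
      rcases lt_or_gt_of_ne h1 with h | h
      · exact Or.inl ⟨h, (hlt x hx y hy h).lt_of_ne h2.symm⟩
      · exact Or.inr ⟨h, (hlt y hy x hx h).lt_of_ne h2⟩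
    have anti : ∀ a b c : ℤ × ℤ, a ∈ s → b ∈ s → c ∈ s → a.1 < b.1 → b.1 < c.1 → c.2 < b.2 →
        b.2 < a.2 → False := fun a b c h1 h2 h3 h4 h5 h6 h7 => hn (a, b, c) ⟨h1, h2, h3, h4, h5, h6, h7⟩
    rcases cmp x hx y hy h1 h4 with ⟨k1, k2⟩ | ⟨k1, k2⟩ <;>
    rcases cmp x hx z hz h2 h5 with ⟨k3, k4⟩ | ⟨k3, k4⟩ <;>
    rcases cmp y hy z hz h3 h6 with ⟨k5, k6⟩ | ⟨k5, k6⟩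
    · exact anti x y z hx hy hz k1 k5 k6 k2
    · exact anti x z y hx hz hy k3 k5 k6 k4
    · omega
    · exact anti z x y hz hx hy k3 k1 k2 k4
    · exact anti y x z hy hx hz k1 k3 k4 k2
    · omega
    · exact anti y z x hy hz hx k5 k3 k4 k6
    · exact anti z y x hz hy hx k5 k1 k2 k6
  rcases key with h | h | h
  · exact (rows hs hc h).imp_right fun ⟨a, b, h1, h2⟩ => ⟨a, b, h1, Or.inl h2⟩
  · obtain ⟨u, v, h⟩ := h
    rcases rows (hs.tr hc) hc.tr ⟨u, v, fun x hx => h _ (mem_transpose.1 hx)⟩ with h | ⟨a, b, h1, h2⟩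
    · exact Or.inl (by simpa using h.tr)
    · exact Or.inr ⟨a, b, h1, Or.inr h2⟩
  · exact Or.inl h

/-- The number of cells of `s` in row `i`. -/
def rowCard (s : Finset (ℤ × ℤ)) (i : ℤ) : ℕ := (s.filter fun x => x.1 = i).card

/-- The number of cells of `s` in column `j`. -/
def colCard (s : Finset (ℤ × ℤ)) (j : ℤ) : ℕ := (s.filter fun x => x.2 = j).card

theorem colCard_transpose (s : Finset (ℤ × ℤ)) (i : ℤ) : colCard (transpose s) i = rowCard s i := by
  unfold colCard rowCard
  rw [← card_transpose (s.filter fun x => x.1 = i)]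
  congr 1
  ext x
  simp

theorem colCard_halfTurn (s : Finset (ℤ × ℤ)) (i : ℤ) :
    colCard (halfTurn s) i = colCard s (-i) := by
  unfold colCard
  rw [← card_halfTurn (s.filter fun x => x.2 = -i)]
  congr 1
  ext x
  simp

theorem rowCard_halfTurn (s : Finset (ℤ × ℤ)) (i : ℤ) :
    rowCard (halfTurn s) i = rowCard s (-i) := by
  unfold rowCard
  rw [← card_halfTurn (s.filter fun x => x.1 = -i)]
  congr 1
  ext x
  simp

theorem column_le_descents (j : ℤ) (L : List (ℤ × ℤ)) : ∀ a, (a :: L).Pairwise Bef →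
    (L.countP fun x => x.2 = j) ≤ (des (a :: L)).count true + 1 ∧
    ((∀ x ∈ L, x.2 = j → a.1 < x.1) →
      (L.countP fun x => x.2 = j) ≤ (des (a :: L)).count true) := by
  induction L with
  | nil => simp
  | cons b L ih =>
    intro a h
    have hb := (List.pairwise_cons.1 h).2
    obtain ⟨h1, h2⟩ := ih b hb
    have h3 : (des (b :: L)).count true ≤ (des (a :: b :: L)).count true := by
      simp [des, List.count_cons]
    by_cases hbj : b.2 = j
    · have h4 := h2 fun x hx hxj => by
        have := (List.pairwise_cons.1 hb).1 x hx
        by_contra h5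
        exact this ⟨by omega, by omega⟩
      refine ⟨by simp only [List.countP_cons, hbj]; simp; omega, fun h5 => ?_⟩
      have h6 := h5 b (by simp) hbj
      simp [des, hbj, h6, h4]
    · refine ⟨by simp only [List.countP_cons, hbj]; simp; omega, fun h5 => ?_⟩
      by_cases h6 : a.1 < b.1
      · simp only [des, List.countP_cons, hbj, List.count_cons, h6]
        simp
        omega
      · have := h2 fun x hx hxj => by
          have := h5 x (by simp [hx]) hxj
          omega
        simp only [List.countP_cons, hbj]
        simp
        omega

theorem IsLin.colCard_le {s : Finset (ℤ × ℤ)} {L} (h : IsLin s L) (j : ℤ) :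
    colCard s j ≤ (des L).count true + 1 := by
  have h1 : colCard s j = L.countP fun x => x.2 = j := by
    rw [List.countP_eq_length_filter, ← List.toFinset_card_of_nodup (h.nodup.filter _)]
    unfold colCard
    congr 1
    ext x
    simp [h.mem]
  rw [h1]
  cases L with
  | nil => simp
  | cons a L =>
    obtain ⟨h2, h3⟩ := column_le_descents j L a h.pw
    by_cases haj : a.2 = j
    · have := h3 fun x hx hxj => by
        have := (List.pairwise_cons.1 h.pw).1 x hx
        by_contra h5
        exact this ⟨by omega, by omega⟩
      simp only [List.countP_cons, haj]
      simpa
    · simp only [List.countP_cons, haj]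
      simpa

theorem IsLin.rowCard_le {s : Finset (ℤ × ℤ)} {L} (h : IsLin s L) (hc : Cvx s) (i : ℤ) :
    rowCard s i ≤ (des L).count false + 1 := by
  have := h.tr.colCard_le i
  rw [colCard_transpose, des_map_swap hc L [] h] at this
  have e : List.count true (List.map not (des L)) = (des L).count false := by
    rw [← List.count_map_of_injective _ not Bool.not_injective false]
    rfl
  rwa [e] at this

theorem exists_shuffle (i : ℤ) (β : List Bool) : ∀ (R C : List (ℤ × ℤ)) (a : ℤ × ℤ),
    R.length = β.count false → C.length = β.count true → R.Pairwise Bef → C.Pairwise Bef →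
    (∀ r ∈ R, r.1 = i) → (∀ c ∈ C, i < c.1) → (∀ r ∈ R, ∀ c ∈ C, c.2 < r.2) →
    (∀ c ∈ C, ∀ c' ∈ C, c.2 = c'.2) → i ≤ a.1 → (∀ c ∈ C, a.1 < c.1) →
    ∃ L : List (ℤ × ℤ), (∀ x, x ∈ L ↔ x ∈ R ∨ x ∈ C) ∧ L.Pairwise Bef ∧ des (a :: L) = β := by
  induction β with
  | nil =>
    intro R C a h1 h2 _ _ _ _ _ _ _ _
    simp only [List.count_nil, List.length_eq_zero_iff] at h1 h2
    subst h1 h2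
    exact ⟨[], by simp, List.Pairwise.nil, rfl⟩
  | cons b β ih =>
    intro R C a h1 h2 hR hC hRi hCi hRC hCC ha haC
    cases b with
    | true =>
      cases C with
      | nil => simp at h2
      | cons c C =>
        simp only [List.count_cons, List.length_cons] at h1 h2
        obtain ⟨L, hL, hLp, hd⟩ := ih R C c (by simpa using h1) (by simpa using h2) hR hC.of_cons hRi
          (fun x hx => hCi x (by simp [hx])) (fun r hr x hx => hRC r hr x (by simp [hx]))
          (fun x hx y hy => hCC x (by simp [hx]) y (by simp [hy])) (hCi c (by simp)).le
          (fun x hx => by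
            have h3 := (List.pairwise_cons.1 hC).1 x hx
            have h4 := hCC x (by simp [hx]) c (by simp)
            by_contra h5
            exact h3 ⟨by omega, by omega⟩)
        refine ⟨c :: L, fun x => ?_, ?_, ?_⟩
        · simp only [List.mem_cons, hL]; tauto
        · rw [List.pairwise_cons]
          refine ⟨fun x hx => ?_, hLp⟩
          rcases (hL x).1 hx with hx | hx
          · have := hRC x hx c (by simp)
            exact fun h => by omega
          · exact (List.pairwise_cons.1 hC).1 x hx
        · simp only [des, hd]
          simp [haC c (by simp)]
    | false =>
      cases R with
      | nil => simp at h1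
      | cons r R =>
        simp only [List.count_cons, List.length_cons] at h1 h2
        have hri := hRi r (by simp)
        obtain ⟨L, hL, hLp, hd⟩ := ih R C r (by simpa using h1) (by simpa using h2) hR.of_cons hC
          (fun x hx => hRi x (by simp [hx])) hCi (fun x hx c hc => hRC x (by simp [hx]) c hc)
          hCC hri.ge (fun c hc => hri ▸ hCi c hc)
        refine ⟨r :: L, fun x => ?_, ?_, ?_⟩
        · simp only [List.mem_cons, hL]; tauto
        · rw [List.pairwise_cons]
          refine ⟨fun x hx => ?_, hLp⟩
          rcases (hL x).1 hx with hx | hx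
          · exact (List.pairwise_cons.1 hR).1 x hx
          · have := hCi x hx
            exact fun h => by omega
        · simp only [des, hd]
          simp [hri, ha]

theorem mem_supp_of_hook {s : Finset (ℤ × ℤ)} (hc : Cvx s) {i j : ℤ}
    (h : ∀ x ∈ s, x.1 = i ∨ (x.2 = j ∧ i < x.1)) {β : List Bool} (hβ : β.length = s.card - 1)
    (hcol : colCard s j ≤ β.count true + 1) (hrow : rowCard s i ≤ β.count false + 1) :
    β ∈ Supp s := by
  rcases s.eq_empty_or_nonempty with rfl | hne
  · exact ⟨[], ⟨by simp, List.Pairwise.nil⟩, by simpa [des, eq_comm] using hβ⟩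
  have hpos := hne.card_pos
  obtain ⟨R, hR⟩ := exists_isLin (s.filter fun x => x.1 = i)
  obtain ⟨C, hC⟩ := exists_isLin (s.filter fun x => ¬ x.1 = i)
  have hcard := Finset.card_filter_add_card_filter_not (s := s) (fun x => x.1 = i)
  have hRl := hR.length_eq
  have hCl := hC.length_eq
  have hRm := hR.mem
  have hCm := hC.mem
  rw [← hRl, ← hCl] at hcard
  unfold rowCard at hrow
  rw [← hRl] at hrow
  simp only [Finset.mem_filter] at hRm hCm
  have hCj : ∀ c ∈ C, c.2 = j ∧ i < c.1 := fun c hc => by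
    have := (hCm c).1 hc
    exact (h c this.1).resolve_left this.2
  have hRj : ∀ r ∈ R, ∀ c ∈ C, j ≤ r.2 := fun r hr c hc' => by
    have h1 := (hRm r).1 hr
    have h2 := (hCm c).1 hc'
    have h3 := hCj c hc'
    by_contra h4
    have h5 := h _ (hc (i := r.1) (j := r.2) (i' := c.1) (j' := c.2) h1.1 h2.1 (x := i + 1) (y := r.2)
      (by omega) (by omega) le_rfl (by omega))
    dsimp only at h5
    omega
  have hcount : β.count true + β.count false = β.length := by
    rw [← List.count_true_add_count_false]
  have hC1 : C.length ≤ colCard s j := by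
    rw [hCl]
    refine Finset.card_le_card fun x hx => ?_
    rw [Finset.mem_filter] at hx ⊢
    exact ⟨hx.1, ((h x hx.1).resolve_left hx.2).1⟩
  have hC2 : (i, j) ∈ s → C.length + 1 ≤ colCard s j := fun hij => by
    rw [hCl, ← Finset.card_insert_of_notMem (a := (i, j)) (by simp)]
    refine Finset.card_le_card fun x hx => ?_
    rw [Finset.mem_insert, Finset.mem_filter] at hx
    rw [Finset.mem_filter]
    rcases hx with rfl | hx
    · exact ⟨hij, rfl⟩
    · exact ⟨hx.1, ((h x hx.1).resolve_left hx.2).1⟩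
  have hRi : ∀ r ∈ R, r.1 = i := fun r hr => ((hRm r).1 hr).2
  by_cases hk : β.count true = C.length
  · cases R with
    | nil => simp at hcard hrow; omega
    | cons r R =>
      simp only [List.length_cons] at hcard hrow
      obtain ⟨L, hL, hLp, hd⟩ := exists_shuffle i β R C r (by omega) hk.symm hR.pw.of_cons hC.pw
        (fun x hx => hRi x (by simp [hx])) (fun c hc => (hCj c hc).2)
        (fun x hx c hc => by
          have h1 := (List.pairwise_cons.1 hR.pw).1 x hx
          have h2 := hRi x (by simp [hx])
          have h3 := hRi r (by simp)
          have h4 := hCj c hc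
          have h5 := hRj r (by simp) c hc
          by_contra h6
          exact h1 ⟨by omega, by omega⟩)
        (fun c hc c' hc' => by rw [(hCj c hc).1, (hCj c' hc').1]) (hRi r (by simp)).ge
        (fun c hc => hRi r (by simp) ▸ (hCj c hc).2)
      refine ⟨r :: L, ⟨fun x => ?_, ?_⟩, hd⟩
      · rw [List.mem_cons, hL, ← or_assoc, ← List.mem_cons, hRm, hCm]
        tauto
      · refine List.pairwise_cons.2 ⟨fun x hx => ?_, hLp⟩
        rcases (hL x).1 hx with hx | hx
        · exact (List.pairwise_cons.1 hR.pw).1 x hx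
        · have h2 := hCj x hx
          have h3 := hRi r (by simp)
          exact fun h => by omega
  · have hij : (i, j) ∉ s := fun hij => by
      have h1 := hC2 hij
      have h2 := List.length_pos_of_mem ((hRm (i, j)).2 ⟨hij, rfl⟩)
      omega
    cases C with
    | nil => simp only [List.length_nil] at hcard hC1 hk; omega
    | cons c C =>
      simp only [List.length_cons] at hcard hC1 hk
      have hRlt : ∀ r ∈ R, j < r.2 := fun r hr => (hRj r hr c (by simp)).lt_of_ne fun h1 => by
        have h2 := (hRm r).1 hr
        exact hij (by rw [h1, ← h2.2]; exact h2.1)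
      obtain ⟨L, hL, hLp, hd⟩ := exists_shuffle i β R C c (by omega) (by omega) hR.pw hC.pw.of_cons
        hRi (fun x hx => (hCj x (by simp [hx])).2)
        (fun r hr x hx => (hCj x (by simp [hx])).1 ▸ hRlt r hr)
        (fun x hx y hy => by rw [(hCj x (by simp [hx])).1, (hCj y (by simp [hy])).1])
        (hCj c (by simp)).2.le
        (fun x hx => by
          have h1 := (List.pairwise_cons.1 hC.pw).1 x hx
          have h2 := hCj x (by simp [hx])
          have h3 := hCj c (by simp)
          by_contra h6
          exact h1 ⟨by omega, by omega⟩)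
      refine ⟨c :: L, ⟨fun x => ?_, ?_⟩, hd⟩
      · rw [List.mem_cons, hL, or_left_comm, ← List.mem_cons, hRm, hCm]
        tauto
      · refine List.pairwise_cons.2 ⟨fun x hx => ?_, hLp⟩
        rcases (hL x).1 hx with hx | hx
        · have h2 := hCj c (by simp)
          have h3 := hRlt x hx
          exact fun h => by omega
        · exact (List.pairwise_cons.1 hC.pw).1 x hx

theorem Cross.mem_supp {s : Finset (ℤ × ℤ)} (hs : Cross s) (hc : Cvx s) {β : List Bool}
    (hβ : β.length = s.card - 1) (hcol : ∀ j, colCard s j ≤ β.count true + 1)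
    (hrow : ∀ i, rowCard s i ≤ β.count false + 1) : β ∈ Supp s := by
  obtain ⟨i, j, h⟩ := hs
  by_cases hbelow : ∃ r, i < r ∧ (r, j) ∈ s
  · by_cases habove : ∃ r, r < i ∧ (r, j) ∈ s
    · obtain ⟨r, hr, hrs⟩ := hbelow
      obtain ⟨r', hr', hrs'⟩ := habove
      have hj : ∀ x ∈ s, x.2 = j := fun ⟨a, b⟩ hx => by
        by_contra hxj
        obtain rfl : a = i := (h _ hx).resolve_right hxj
        dsimp only at hxj
        rcases lt_or_gt_of_ne hxj with hlt | hlt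
        · have := h _ (hc hx hrs (x := a + 1) (y := b) (by omega) (by omega) le_rfl hlt.le)
          dsimp only at this
          omega
        · have := h _ (hc hrs' hx (x := a - 1) (y := b) (by omega) (by omega) hlt.le le_rfl)
          dsimp only at this
          omega
      obtain ⟨m, hm, hmin⟩ := s.exists_min_image Prod.fst ⟨_, hrs⟩
      exact mem_supp_of_hook hc (i := m.1) (j := j)
        (fun x hx => (hmin x hx).eq_or_lt.imp Eq.symm fun h => ⟨hj x hx, h⟩) hβ (hcol j) (hrow _)
    · refine mem_supp_of_hook hc (i := i) (j := j) (fun ⟨a, b⟩ hx => ?_) hβ (hcol j) (hrow i)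
      by_cases ha : a = i
      · exact Or.inl ha
      have hb := (h _ hx).resolve_left ha
      dsimp only at hb ⊢
      subst hb
      have : ¬ a < i := fun hlt => habove ⟨a, hlt, hx⟩
      omega
  · rw [← List.reverse_reverse β, ← supp_halfTurn]
    refine mem_supp_of_hook hc.ng (i := -i) (j := -j) (fun ⟨a, b⟩ hx => ?_)
      (by rw [List.length_reverse, card_halfTurn, hβ])
      (by rw [colCard_halfTurn, List.count_reverse]; exact hcol _)
      (by rw [rowCard_halfTurn, List.count_reverse]; exact hrow _)
    rw [mem_halfTurn] at hx
    have h1 := h _ hx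
    have h2 : b = -j → ¬ i < -a := fun hb hlt => hbelow ⟨-a, hlt, by subst hb; simpa using hx⟩
    dsimp only at h1 ⊢
    omega

/-- Marks the positions of a Boolean word where `false` is followed by `true`. -/
def wdes : List Bool → List Bool
  | [] => []
  | [_] => []
  | a :: b :: l => (!a && b) :: wdes (b :: l)

/-- The number of letters `true` not matched with an earlier `false`. -/
def unmatched : List Bool → ℕ
  | [] => 0
  | true :: w => unmatched w + 1
  | false :: w => unmatched w - 1

/-- Replaces each `false` not matched with a later `true` by `true`. -/
def raise : List Bool → List Bool
  | [] => []
  | true :: w => true :: raise w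
  | false :: w => decide (unmatched w = 0) :: raise w

theorem wdes_raise (w : List Bool) : wdes (raise w) = wdes w := by
  induction w with
  | nil => rfl
  | cons a w ih =>
    cases w with
    | nil => cases a <;> rfl
    | cons b w =>
      cases a <;> cases b <;> simp only [raise, wdes, unmatched] at ih ⊢ <;> simp [ih]
      intro h
      have : ¬ unmatched w - 1 = 0 := of_decide_eq_false h
      omega

theorem count_raise (w : List Bool) : (raise w).count false + unmatched w = w.count true := by
  induction w with
  | nil => rfl
  | cons a w ih =>
    cases a
    · by_cases h : unmatched w = 0 <;> simp [raise, unmatched, h] <;> omega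
    · simp [raise, unmatched]; omega

theorem length_raise (w : List Bool) : (raise w).length = w.length := by
  induction w with
  | nil => rfl
  | cons a w ih => cases a <;> simp [raise, ih]

theorem unmatched_le (w : List Bool) : ∀ d, (∀ l r, l ++ r = w → l.count true ≤ l.count false + d) →
    unmatched w ≤ d := by
  induction w with
  | nil => simp [unmatched]
  | cons a w ih =>
    intro d h
    cases a with
    | true =>
      have h1 := h [true] w rfl
      simp at h1
      have := ih (d - 1) fun l r hlr => by
        have := h (true :: l) r (by simp [hlr])
        simp at this
        omega
      simp only [unmatched]
      omega
    | false =>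
      have := ih (d + 1) fun l r hlr => by
        have := h (false :: l) r (by simp [hlr])
        simp at this
        omega
      simp only [unmatched]
      omega

/-- Every suffix has at least as many letters `true` as letters `false`. -/
def Dominated : List Bool → Prop
  | [] => True
  | a :: w => (a :: w).count false ≤ (a :: w).count true ∧ Dominated w

theorem dominated_raise_aux (w : List Bool) :
    (raise w).count false + unmatched w ≤ (raise w).count true ∧ Dominated (raise w) := by
  induction w with
  | nil => simp [raise, unmatched, Dominated]
  | cons a w ih =>
    obtain ⟨h1, h2⟩ := ih
    cases a
    · by_cases h : unmatched w = 0 <;> simp [raise, unmatched, Dominated, h, h2] <;> omega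
    · simp [raise, unmatched, Dominated, h2]; omega

/-- The cells of two rows ending in the same column, listed in the order given by a word. -/
def fill (u e : ℤ) : List Bool → List (ℤ × ℤ)
  | [] => []
  | false :: w => (u, e - (false :: w).count false) :: fill u e w
  | true :: w => (u + 1, e - (true :: w).count true) :: fill u e w

theorem mem_fill (u e : ℤ) (w : List Bool) (x : ℤ × ℤ) : x ∈ fill u e w ↔
    (x.1 = u ∧ e - w.count false ≤ x.2 ∧ x.2 < e) ∨
      (x.1 = u + 1 ∧ e - w.count true ≤ x.2 ∧ x.2 < e) := by
  obtain ⟨i, j⟩ := x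
  induction w with
  | nil => simp [fill]
  | cons a w ih =>
    cases a <;> simp [fill, ih, Prod.ext_iff] <;> omega

theorem pairwise_fill (u e : ℤ) (w : List Bool) (h : Dominated w) : (fill u e w).Pairwise Bef := by
  induction w with
  | nil => exact List.Pairwise.nil
  | cons a w ih =>
    have h1 := h.1
    have hw := ih h.2
    have h3 : w.count false ≤ w.count true := by
      cases w with
      | nil => simp
      | cons => exact h.2.1
    cases a
    · refine List.pairwise_cons.2 ⟨fun x hx hb => ?_, hw⟩
      have := (mem_fill u e w x).1 hx
      simp at hb h1
      omega
    · refine List.pairwise_cons.2 ⟨fun x hx hb => ?_, hw⟩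
      have := (mem_fill u e w x).1 hx
      simp at hb h1
      omega

theorem des_fill (u e : ℤ) (w : List Bool) : des (fill u e w) = wdes w := by
  induction w with
  | nil => rfl
  | cons a w ih =>
    cases w with
    | nil => cases a <;> rfl
    | cons b w => cases a <;> cases b <;> simp [fill, des, wdes] at ih ⊢ <;> exact ih

theorem wdes_map_row {u : ℤ} {L : List (ℤ × ℤ)} (h : ∀ x ∈ L, x.1 = u ∨ x.1 = u + 1) :
    wdes (L.map fun x => decide (x.1 = u + 1)) = des L := by
  induction L with
  | nil => rfl
  | cons a L ih =>
    cases L with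
    | nil => rfl
    | cons b L =>
      have h1 := h a (by simp)
      have h2 := h b (by simp)
      have h3 := ih fun x hx => h x (by simp [hx])
      simp only [List.map_cons, wdes, des] at h3 ⊢
      rw [h3]
      congr 1
      rcases h1 with h1 | h1 <;> rcases h2 with h2 | h2 <;> simp [h1, h2]

theorem rowCard_eq {s : Finset (ℤ × ℤ)} {i p q : ℤ} (h : ∀ j, (i, j) ∈ s ↔ p ≤ j ∧ j < q) :
    rowCard s i = (q - p).toNat := by
  rw [← Int.card_Ico, ← Finset.card_image_of_injective (Finset.Ico p q) (Prod.mk_right_injective i)]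
  unfold rowCard
  congr 1
  ext ⟨a, c⟩
  simp only [Finset.mem_filter, Finset.mem_image, Finset.mem_Ico, ← h, Prod.mk.injEq]
  constructor
  · rintro ⟨h1, rfl⟩
    exact ⟨c, h1, rfl, rfl⟩
  · rintro ⟨_, h1, rfl, rfl⟩
    exact ⟨h1, rfl⟩

theorem IsLin.countP_row {s : Finset (ℤ × ℤ)} {L} (h : IsLin s L) (i : ℤ) :
    (L.countP fun x => x.1 = i) = rowCard s i := by
  rw [List.countP_eq_length_filter, ← List.toFinset_card_of_nodup (h.nodup.filter _)]
  unfold rowCard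
  congr 1
  ext x
  simp [h.mem]

theorem Straight.supp_subset {s t : Finset (ℤ × ℤ)} {a b u x u' x' : ℤ} (hba : b ≤ a) (hb : 0 ≤ b)
    (hs : Straight s a b u x) (ht : Rotated t a b u' x') :
    Supp s ⊆ Supp t := by
  rintro β ⟨L, hL, rfl⟩
  have hrow : ∀ y ∈ L, y.1 = u ∨ y.1 = u + 1 := fun ⟨i, j⟩ hy => by
    have := (hs i j).1 ((hL.mem _).1 hy)
    dsimp only
    omega
  set w := L.map fun x => decide (x.1 = u + 1) with hw
  have hD : (w.count true : ℤ) = b := by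
    have e : w.count true = rowCard s (u + 1) := by
      rw [← hL.countP_row, hw, List.count, List.countP_map]
      congr 1
      ext y
      simp
    rw [e, rowCard_eq (p := x) (q := x + b) fun j => by rw [hs]; omega]
    omega
  have hlen : (w.length : ℤ) = a + b := by
    have e : w.count false = rowCard s u := by
      rw [← hL.countP_row, hw, List.count, List.countP_map]
      refine List.countP_congr fun y hy => ?_
      have := hrow y hy
      simp
      omega
    rw [rowCard_eq (p := x) (q := x + a) fun j => by rw [hs]; omega] at e
    have := List.count_true_add_count_false w
    omega
  have hpre : unmatched w ≤ 0 := by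
    refine unmatched_le w 0 fun l r hlr => ?_
    obtain ⟨L₁, L₂, rfl, rfl, rfl⟩ := List.map_eq_append_iff.1 hlr.symm
    have hnd := hL.nodup.of_append_left
    have hp := List.pairwise_append.1 hL.pw
    simp only [List.count, List.countP_map, Nat.add_zero]
    simp only [List.countP_eq_length_filter]
    rw [← List.toFinset_card_of_nodup (hnd.filter _), ← List.toFinset_card_of_nodup (hnd.filter _)]
    refine Finset.card_le_card_of_injOn (fun y => (u, y.2)) (fun ⟨i, j⟩ hy => ?_)
      (fun ⟨i, j⟩ hy ⟨i', j'⟩ hy' h => ?_)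
    · simp at hy ⊢
      obtain ⟨hy, rfl⟩ := hy
      have hys := (hL.mem _).1 (List.mem_append_left _ hy)
      have hjs := (hs u j).2 (by have := (hs _ _).1 hys; omega)
      refine (List.mem_append.1 ((hL.mem _).2 hjs)).resolve_right fun h => ?_
      exact hp.2.2 _ hy _ h ⟨by dsimp only; omega, le_rfl⟩
    · simp at hy hy' h ⊢
      omega
  have h1 := count_raise w
  have h2 := length_raise w
  have h3 : (raise w).count true + (raise w).count false = (raise w).length :=
    List.count_true_add_count_false _
  refine ⟨fill u' (x' + a) (raise w), ⟨fun ⟨i, j⟩ => ?_, ?_⟩, ?_⟩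
  · rw [mem_fill, ht]
    dsimp only
    omega
  · exact pairwise_fill _ _ _ (dominated_raise_aux w).2
  · rw [des_fill, wdes_raise, hw, wdes_map_row hrow]

theorem Straight.halfTurn {s : Finset (ℤ × ℤ)} {a b u x : ℤ} (h : Straight s a b u x) :
    Rotated (halfTurn s) a b (-u - 1) (-x - a + 1) := fun i j => by
  rw [mem_halfTurn, h]
  omega

theorem Rotated.halfTurn {s : Finset (ℤ × ℤ)} {a b u x : ℤ} (h : Rotated s a b u x) :
    Straight (halfTurn s) a b (-u - 1) (-x - a + 1) := fun i j => by
  rw [mem_halfTurn, h]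
  omega

theorem Rotated.supp_subset {s t : Finset (ℤ × ℤ)} {a b u x u' x' : ℤ} (hba : b ≤ a) (hb : 0 ≤ b)
    (hs : Rotated s a b u x) (ht : Straight t a b u' x') : Supp s ⊆ Supp t := fun β hβ => by
  rw [← List.reverse_reverse β, ← supp_halfTurn] at hβ ⊢
  exact Straight.supp_subset hba hb hs.halfTurn ht.halfTurn hβ

theorem TR.supp_subset {s t : Finset (ℤ × ℤ)} {a b : ℤ} (hb : 0 ≤ b) (hs : TR s a b)
    (ht : TR t a b) : Supp s ⊆ Supp t := by
  obtain ⟨hba, u, x, hs⟩ := hs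
  obtain ⟨-, u', x', ht⟩ := ht
  rcases hs with hs | hs <;> rcases ht with ht | ht
  · exact (Straight.supp_subset hba hb hs (Straight.halfTurn hs)).trans
      (Rotated.supp_subset hba hb (Straight.halfTurn hs) ht)
  · exact Straight.supp_subset hba hb hs ht
  · exact Rotated.supp_subset hba hb hs ht
  · exact (Rotated.supp_subset hba hb hs (Rotated.halfTurn hs)).trans
      (Straight.supp_subset hba hb (Rotated.halfTurn hs) ht)

/-- The number of columns shared by rows `i` and `i + 1` of `s`. -/
def pairOverlap (s : Finset (ℤ × ℤ)) (i : ℤ) : ℕ :=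
  rowCard (s.filter fun x => (x.1 + 1, x.2) ∈ s) i

theorem Has22.two_le_pairOverlap {s : Finset (ℤ × ℤ)} (h : Has22 s) : ∃ i, 2 ≤ pairOverlap s i := by
  obtain ⟨i, j, h1, h2, h3, h4⟩ := h
  refine ⟨i, ?_⟩
  rw [← Finset.card_pair (a := (i, j)) (b := (i, j + 1)) (by simp)]
  refine Finset.card_le_card fun x hx => ?_
  rw [Finset.mem_insert, Finset.mem_singleton] at hx
  rcases hx with rfl | rfl <;> simp [*]

theorem Cvx.has22_of_pairOverlap {s : Finset (ℤ × ℤ)} (hc : Cvx s) {i : ℤ}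
    (h : 2 ≤ pairOverlap s i) : Has22 s := by
  obtain ⟨⟨a, b⟩, hx, ⟨a', b'⟩, hy, hne⟩ := Finset.one_lt_card.1 h
  simp only [Finset.mem_filter] at hx hy
  obtain ⟨⟨hx, hx'⟩, rfl⟩ := hx
  obtain ⟨⟨hy, hy'⟩, rfl⟩ := hy
  have : b ≠ b' := fun h => hne (by rw [h])
  rcases lt_or_gt_of_ne this with h | h
  · exact hc.has22 hx hy' (by simp) h
  · exact hc.has22 hy hx' (by simp) h

theorem Has22.not_cross {s : Finset (ℤ × ℤ)} (h : Has22 s) : ¬ Cross s := by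
  rintro ⟨r, c, hs⟩
  obtain ⟨i, j, h1, h2, h3, h4⟩ := h
  have := hs _ h1
  have := hs _ h2
  have := hs _ h3
  have := hs _ h4
  dsimp only at *
  omega

theorem Has22.transpose {s : Finset (ℤ × ℤ)} (h : Has22 s) : Has22 (transpose s) := by
  obtain ⟨i, j, h1, h2, h3, h4⟩ := h
  exact ⟨j, i, by simpa, by simpa, by simpa, by simpa⟩

theorem TR.has22 {s : Finset (ℤ × ℤ)} {a b : ℤ} (h : TR s a b) (hb : 2 ≤ b) : Has22 s := by
  obtain ⟨hba, u, x, h | h⟩ := h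
  · refine ⟨u, x, ?_⟩
    rw [h, h, h, h]
    omega
  · refine ⟨u, x + a - b, ?_⟩
    rw [h, h, h, h]
    omega

theorem rowCard_eq_zero {s : Finset (ℤ × ℤ)} {i : ℤ} (h : ∀ j, (i, j) ∉ s) : rowCard s i = 0 := by
  refine Finset.card_eq_zero.2 (Finset.filter_eq_empty_iff.2 ?_)
  rintro ⟨r, c⟩ hx rfl
  exact h c hx

theorem TR.rowCard {s : Finset (ℤ × ℤ)} {a b : ℤ} (h : TR s a b) (hb : 1 ≤ b) :
    (s.card : ℤ) = a + b ∧ (∃ i, (rowCard s i : ℤ) = a) ∧ ∀ i, (rowCard s i : ℤ) ≤ a := by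
  obtain ⟨hba, u, x, h⟩ := h
  have key : ∃ m n : ℤ, SkewPaper.rowCard s u = m ∧ SkewPaper.rowCard s (u + 1) = n ∧
      (m = a ∧ n = b ∨ m = b ∧ n = a) := by
    rcases h with h | h
    · refine ⟨a, b, ?_, ?_, Or.inl ⟨rfl, rfl⟩⟩
      · rw [rowCard_eq (p := x) (q := x + a) fun j => by rw [h]; omega]
        omega
      · rw [rowCard_eq (p := x) (q := x + b) fun j => by rw [h]; omega]
        omega
    · refine ⟨b, a, ?_, ?_, Or.inr ⟨rfl, rfl⟩⟩
      · rw [rowCard_eq (p := x + a - b) (q := x + a) fun j => by rw [h]; omega]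
        omega
      · rw [rowCard_eq (p := x) (q := x + a) fun j => by rw [h]; omega]
        omega
  have hrow : ∀ y ∈ s, y.1 = u ∨ y.1 = u + 1 := by
    rintro ⟨i, j⟩ hy
    rcases h with h | h
    · have := (h i j).1 hy
      dsimp only
      omega
    · have := (h i j).1 hy
      dsimp only
      omega
  obtain ⟨m, n, hm, hn, hmn⟩ := key
  have hcard : s.card = SkewPaper.rowCard s u + SkewPaper.rowCard s (u + 1) := by
    rw [← Finset.card_filter_add_card_filter_not (s := s) (fun x => x.1 = u)]
    unfold SkewPaper.rowCard
    congr 2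
    refine Finset.filter_congr fun y hy => ?_
    have := hrow y hy
    omega
  refine ⟨by omega, ?_, fun i => ?_⟩
  · rcases hmn with h | h
    · exact ⟨u, by omega⟩
    · exact ⟨u + 1, by omega⟩
  · by_cases h1 : i = u
    · subst h1; omega
    by_cases h2 : i = u + 1
    · subst h2; omega
    rw [rowCard_eq_zero fun j hj => by have := hrow _ hj; dsimp only at this; omega]
    omega

theorem TR.pairOverlap {s : Finset (ℤ × ℤ)} {a b : ℤ} (h : TR s a b) (hb : 1 ≤ b) :
    (∃ i, (pairOverlap s i : ℤ) = b) ∧ ∀ i, (pairOverlap s i : ℤ) ≤ b := by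
  obtain ⟨hba, u, x, h⟩ := h
  have key : (SkewPaper.pairOverlap s u : ℤ) = b ∧ ∀ i, i ≠ u → SkewPaper.pairOverlap s i = 0 := by
    unfold SkewPaper.pairOverlap
    rcases h with h | h
    · constructor
      · rw [rowCard_eq (p := x) (q := x + b) fun j => by
          simp only [Finset.mem_filter]; rw [h, h]; omega]
        omega
      · refine fun i hi => rowCard_eq_zero fun j hj => ?_
        simp only [Finset.mem_filter] at hj
        rw [h, h] at hj
        omega
    · constructor
      · rw [rowCard_eq (p := x + a - b) (q := x + a) fun j => by
          simp only [Finset.mem_filter]; rw [h, h]; omega]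
        omega
      · refine fun i hi => rowCard_eq_zero fun j hj => ?_
        simp only [Finset.mem_filter] at hj
        rw [h, h] at hj
        omega
  refine ⟨⟨u, key.1⟩, fun i => ?_⟩
  by_cases hi : i = u
  · rw [hi, key.1]
  · rw [key.2 i hi]
    omega

theorem TR.colCard_le {s : Finset (ℤ × ℤ)} {a b : ℤ} (h : TR s a b) (j : ℤ) : colCard s j ≤ 2 := by
  obtain ⟨hba, u, x, h⟩ := h
  refine (Finset.card_le_card (t := {(u, j), (u + 1, j)}) fun ⟨i, c⟩ hy => ?_).trans
    Finset.card_le_two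
  rw [Finset.mem_filter] at hy
  obtain ⟨hy, rfl⟩ := hy
  simp only [Finset.mem_insert, Finset.mem_singleton, Prod.mk.injEq, and_true]
  rcases h with h | h
  · have := (h _ _).1 hy
    omega
  · have := (h _ _).1 hy
    omega

theorem TR.card_image_snd {s : Finset (ℤ × ℤ)} {a b : ℤ} (h : TR s a b) (hb : 1 ≤ b) :
    ((s.image Prod.snd).card : ℤ) = a := by
  obtain ⟨hba, u, x, h⟩ := h
  have : s.image Prod.snd = Finset.Ico x (x + a) := by
    ext c
    simp only [Finset.mem_image, Finset.mem_Ico, Prod.exists, exists_eq_right]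
    rcases h with h | h
    · constructor
      · rintro ⟨i, hi⟩
        rw [h] at hi
        omega
      · exact fun hc => ⟨u, by rw [h]; omega⟩
    · constructor
      · rintro ⟨i, hi⟩
        rw [h] at hi
        omega
      · exact fun hc => ⟨u + 1, by rw [h]; omega⟩
  rw [this, Int.card_Ico]
  omega

theorem image_fst_eq (s : Finset (ℤ × ℤ)) : s.image Prod.fst = (transpose s).image Prod.snd := by
  unfold SkewPaper.transpose
  rw [Finset.image_image]
  rfl

theorem TR.of_square {s : Finset (ℤ × ℤ)} (h : TR (transpose s) 2 2) : TR s 2 2 := by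
  obtain ⟨hba, u, x, h⟩ := h
  refine ⟨le_rfl, x, u, Or.inl fun i j => ?_⟩
  have e : (i, j) ∈ s ↔ (j, i) ∈ transpose s := by simp
  rw [e]
  rcases h with h | h
  · rw [h]; omega
  · rw [h]; omega

/-- The containment of supports for multiplicity-free convex sets of cells. -/
theorem supp_subset_supp {s t : Finset (ℤ × ℤ)} (hs : MultFree s) (ht : MultFree t) (hcs : Cvx s)
    (hct : Cvx t) (hcard : s.card = t.card) (hrow : ∀ i, ∃ i', rowCard s i ≤ rowCard t i')
    (hcol : ∀ j, ∃ j', colCard s j ≤ colCard t j')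
    (hov : ∀ i, ∃ i', pairOverlap s i ≤ pairOverlap t i')
    (hrows : (t.image Prod.fst).card ≤ (s.image Prod.fst).card) : Supp t ⊆ Supp s := by
  rcases hs.classification hcs with h | ⟨a, b, hb, h⟩
  · rintro β ⟨L, hL, rfl⟩
    refine h.mem_supp hcs ?_ (fun j => ?_) (fun i => ?_)
    · rw [des_length, hL.length_eq, hcard]
    · obtain ⟨j', hj⟩ := hcol j
      exact hj.trans (hL.colCard_le j')
    · obtain ⟨i', hi⟩ := hrow i
      exact hi.trans (hL.rowCard_le hct i')
  have h22s : Has22 s := by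
    rcases h with h | h
    · exact h.has22 hb
    · simpa using (h.has22 hb).transpose
  have h22t : Has22 t := by
    obtain ⟨i, hi⟩ := h22s.two_le_pairOverlap
    obtain ⟨i', hi'⟩ := hov i
    exact hct.has22_of_pairOverlap (hi.trans hi')
  rcases ht.classification hct with h' | ⟨a', b', hb', h'⟩
  · exact (h22t.not_cross h').elim
  have square : TR s 2 2 → TR t 2 2 → Supp t ⊆ Supp s := fun h1 h2 =>
    h2.supp_subset (by norm_num) h1
  rcases h with h | h <;> rcases h' with h' | h'
  · obtain ⟨e1, ⟨i, hi⟩, -⟩ := h.rowCard (by omega)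
    obtain ⟨e2, -, hi'⟩ := h'.rowCard (by omega)
    obtain ⟨⟨k, hk⟩, -⟩ := h.pairOverlap (by omega)
    obtain ⟨-, hk'⟩ := h'.pairOverlap (by omega)
    obtain ⟨i', h1⟩ := hrow i
    obtain ⟨k', h2⟩ := hov k
    have := hi' i'
    have := hk' k'
    obtain rfl : a = a' := by omega
    obtain rfl : b = b' := by omega
    exact h'.supp_subset (by omega) h
  · obtain ⟨e1, ⟨i, hi⟩, -⟩ := h.rowCard (by omega)
    obtain ⟨e2, -, -⟩ := h'.rowCard (by omega)
    rw [card_transpose] at e2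
    obtain ⟨i', h1⟩ := hrow i
    have h2 := h'.colCard_le i'
    rw [colCard_transpose] at h2
    have := h.1
    have := h'.1
    obtain rfl : a = 2 := by omega
    obtain rfl : b = 2 := by omega
    obtain rfl : a' = 2 := by omega
    obtain rfl : b' = 2 := by omega
    exact square h h'.of_square
  · obtain ⟨e1, ⟨i, hi⟩, -⟩ := h.rowCard (by omega)
    obtain ⟨e2, -, -⟩ := h'.rowCard (by omega)
    rw [card_transpose] at e1
    rw [← colCard_transpose, transpose_transpose] at hi
    obtain ⟨i', h1⟩ := hcol i
    have h2 := h'.colCard_le i'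
    have := h.1
    have := h'.1
    obtain rfl : a = 2 := by omega
    obtain rfl : b = 2 := by omega
    obtain rfl : a' = 2 := by omega
    obtain rfl : b' = 2 := by omega
    exact square h.of_square h'
  · obtain ⟨e1, ⟨i, hi⟩, -⟩ := h.rowCard (by omega)
    obtain ⟨e2, -, hi'⟩ := h'.rowCard (by omega)
    rw [card_transpose] at e1 e2
    rw [← colCard_transpose, transpose_transpose] at hi
    obtain ⟨i', h1⟩ := hcol i
    have h2 := hi' i'
    rw [← colCard_transpose, transpose_transpose] at h2
    have h3 := h.card_image_snd (by omega)
    have h4 := h'.card_image_snd (by omega)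
    rw [← image_fst_eq] at h3 h4
    obtain rfl : a = a' := by omega
    obtain rfl : b = b' := by omega
    intro β hβ
    have h5 := (supp_transpose hct (β := β.map not)).2 (by simpa [Function.comp_def] using hβ)
    simpa [Function.comp_def] using (supp_transpose hcs).1 (h'.supp_subset (by omega) h h5)

theorem mem_toZ {s : Finset (ℕ × ℕ)} {x : ℤ × ℤ} :
    x ∈ toZ s ↔ ∃ c ∈ s, ((c.1 : ℤ), (c.2 : ℤ)) = x := Finset.mem_image

theorem natCast_mem_toZ {s : Finset (ℕ × ℕ)} {i j : ℕ} : ((i : ℤ), (j : ℤ)) ∈ toZ s ↔ (i, j) ∈ s := by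
  rw [mem_toZ]
  constructor
  · rintro ⟨⟨a, b⟩, h, e⟩
    simp only [Prod.mk.injEq, Nat.cast_inj] at e
    rwa [← e.1, ← e.2]
  · exact fun h => ⟨_, h, rfl⟩

theorem natCast_pair_injective : Function.Injective fun c : ℕ × ℕ => ((c.1 : ℤ), (c.2 : ℤ)) := by
  rintro ⟨a, b⟩ ⟨c, d⟩ h
  simpa using h

theorem card_toZ (s : Finset (ℕ × ℕ)) : (toZ s).card = s.card :=
  Finset.card_image_of_injective _ natCast_pair_injective

theorem mem_rowCols {s : Finset (ℕ × ℕ)} {i j : ℕ} : j ∈ rowCols s i ↔ (i, j) ∈ s := by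
  simp [rowCols]

theorem overlapRow_eq (s : Finset (ℕ × ℕ)) (k i : ℕ) : overlapRow s k i =
    ((toZ s).filter fun x : ℤ × ℤ =>
      x.1 = (i : ℤ) ∧ ∀ t : ℕ, t < k → (x.1 + (t : ℤ), x.2) ∈ toZ s).card := by
  have hinj : Function.Injective fun j : ℕ => ((i : ℤ), (j : ℤ)) := fun a b h => by simpa using h
  unfold overlapRow
  rw [← Finset.card_image_of_injective _ hinj]
  congr 1
  ext x
  simp only [Finset.mem_image, Finset.mem_filter, mem_rowCols]
  constructor
  · rintro ⟨j, ⟨h1, h2⟩, rfl⟩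
    refine ⟨natCast_mem_toZ.2 h1, rfl, fun t ht => ?_⟩
    have := natCast_mem_toZ.2 (h2 t ht)
    push_cast at this
    exact this
  · rintro ⟨h1, h2, h3⟩
    obtain ⟨⟨a, b⟩, h, rfl⟩ := mem_toZ.1 h1
    simp only [Nat.cast_inj] at h2
    subst h2
    refine ⟨b, ⟨h, fun t ht => ?_⟩, rfl⟩
    have := h3 t ht
    rw [← natCast_mem_toZ]
    push_cast
    exact this

theorem overlapRow_one (s : Finset (ℕ × ℕ)) (i : ℕ) : overlapRow s 1 i = rowCard (toZ s) i := by
  rw [overlapRow_eq]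
  unfold rowCard
  congr 1
  refine Finset.filter_congr fun x hx => ?_
  simp only [Nat.lt_one_iff, forall_eq, Nat.cast_zero, add_zero]
  simp [hx]

theorem overlapRow_two (s : Finset (ℕ × ℕ)) (i : ℕ) : overlapRow s 2 i = pairOverlap (toZ s) i := by
  rw [overlapRow_eq]
  unfold pairOverlap rowCard
  rw [Finset.filter_filter]
  congr 1
  refine Finset.filter_congr fun x hx => ?_
  constructor
  · rintro ⟨h1, h2⟩
    exact ⟨by simpa using h2 1 (by norm_num), h1⟩
  · rintro ⟨h1, h2⟩
    refine ⟨h2, fun t ht => ?_⟩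
    interval_cases t
    · simpa using hx
    · simpa using h1

theorem pairwise_sortDesc (s : Multiset ℕ) : (sortDesc s).Pairwise (· ≥ ·) := by
  unfold sortDesc
  rw [List.pairwise_reverse]
  exact s.pairwise_sort (· ≤ ·)

theorem coe_sortDesc (s : Multiset ℕ) : (sortDesc s : Multiset ℕ) = s := by
  unfold sortDesc
  rw [Multiset.coe_reverse, Multiset.sort_eq]

theorem mem_sortDesc {s : Multiset ℕ} {x : ℕ} : x ∈ sortDesc s ↔ x ∈ s := by
  rw [← Multiset.mem_coe, coe_sortDesc]

theorem Dom.exists_le {s t : Multiset ℕ} (h : Dom s t) {x : ℕ} (hx : x ∈ s) (h0 : 0 < x) :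
    ∃ y ∈ t, x ≤ y := by
  have h1 := h 1
  rw [← mem_sortDesc] at hx
  have hs := pairwise_sortDesc s
  cases e : sortDesc s with
  | nil => simp [e] at hx
  | cons a l =>
    rw [e] at hx hs h1
    have hxa : x ≤ a := by
      rcases List.mem_cons.1 hx with rfl | hx
      · exact le_rfl
      · exact (List.pairwise_cons.1 hs).1 x hx
    cases e' : sortDesc t with
    | nil => simp [e'] at h1; omega
    | cons b l' =>
      rw [e'] at h1
      simp at h1
      exact ⟨b, mem_sortDesc.1 (by simp [e']), hxa.trans h1⟩

theorem Dom.card_le {s t : Multiset ℕ} (h : Dom s t) (hsum : s.sum = t.sum) (ht : ∀ y ∈ t, 0 < y) :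
    Multiset.card t ≤ Multiset.card s := by
  have hc : ∀ u : Multiset ℕ, (sortDesc u).length = Multiset.card u := fun u => by
    rw [← Multiset.coe_card, coe_sortDesc]
  have hsu : ∀ u : Multiset ℕ, (sortDesc u).sum = u.sum := fun u => by
    rw [← Multiset.sum_coe, coe_sortDesc]
  have h1 := h (sortDesc s).length
  rw [List.take_length, hsu, hsum, ← hsu t] at h1
  have h2 := congrArg List.sum (List.take_append_drop (sortDesc s).length (sortDesc t))
  rw [List.sum_append] at h2
  rw [← hc, ← hc, ← List.drop_eq_nil_iff]
  refine List.eq_nil_iff_forall_not_mem.2 fun y hy => ?_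
  have h3 := List.single_le_sum (fun _ _ => Nat.zero_le _) y hy
  have h4 := ht y (mem_sortDesc.1 (List.mem_of_mem_drop hy))
  omega

theorem exists_overlapRow_le {s t : Finset (ℕ × ℕ)} {k : ℕ} (h : Dom (rowsk s k) (rowsk t k))
    (i : ℕ) : ∃ i', overlapRow s k i ≤ overlapRow t k i' := by
  rcases Nat.eq_zero_or_pos (overlapRow s k i) with h0 | h0
  · exact ⟨0, by omega⟩
  have hi : ∃ j, (i, j) ∈ s := by
    obtain ⟨j, hj⟩ := Finset.card_pos.1 h0
    exact ⟨j, mem_rowCols.1 (Finset.mem_filter.1 hj).1⟩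
  obtain ⟨j, hj⟩ := hi
  have hmem : overlapRow s k i ∈ rowsk s k :=
    Multiset.mem_filter.2 ⟨Multiset.mem_map.2 ⟨i, Finset.mem_image.2 ⟨_, hj, rfl⟩, rfl⟩, h0⟩
  obtain ⟨y, hy, hle⟩ := h.exists_le hmem h0
  obtain ⟨i', -, rfl⟩ := Multiset.mem_map.1 (Multiset.mem_filter.1 hy).1
  exact ⟨i', hle⟩

theorem overlapRow_one_eq_card (s : Finset (ℕ × ℕ)) (i : ℕ) :
    overlapRow s 1 i = (s.filter fun c => c.1 = i).card := by
  unfold overlapRow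
  rw [Finset.filter_true_of_mem fun j hj t ht => by
    obtain rfl : t = 0 := by omega
    exact hj]
  refine Finset.card_image_of_injOn ?_
  rintro ⟨a, b⟩ h ⟨c, d⟩ h' e
  simp only [Finset.coe_filter, Set.mem_ofPred_eq] at h h' e
  rw [Prod.mk.injEq]
  exact ⟨by omega, e⟩

theorem rowsk_one (s : Finset (ℕ × ℕ)) :
    rowsk s 1 = (s.image Prod.fst).val.map (overlapRow s 1) := by
  refine Multiset.filter_eq_self.2 fun m hm => ?_
  obtain ⟨i, hi, rfl⟩ := Multiset.mem_map.1 hm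
  obtain ⟨c, hc, rfl⟩ := Finset.mem_image.1 hi
  rw [overlapRow_one_eq_card]
  exact Finset.card_pos.2 ⟨c, Finset.mem_filter.2 ⟨hc, rfl⟩⟩

theorem card_image_fst_le {s t : Finset (ℕ × ℕ)} (h : Dom (rowsk s 1) (rowsk t 1))
    (hcard : s.card = t.card) : (t.image Prod.fst).card ≤ (s.image Prod.fst).card := by
  have hsum : ∀ u : Finset (ℕ × ℕ), (rowsk u 1).sum = u.card := fun u => by
    rw [rowsk_one, Finset.card_eq_sum_card_image Prod.fst u, Finset.sum_eq_multiset_sum]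
    congr 1
    exact Multiset.map_congr rfl fun i _ => overlapRow_one_eq_card u i
  have := h.card_le (by rw [hsum, hsum, hcard]) fun y hy => (Multiset.mem_filter.1 hy).2
  rw [rowsk_one, rowsk_one, Multiset.card_map, Multiset.card_map] at this
  exact this

theorem card_image_fst_toZ (s : Finset (ℕ × ℕ)) :
    ((toZ s).image Prod.fst).card = (s.image Prod.fst).card := by
  rw [← Finset.card_image_of_injective (s.image Prod.fst) (Nat.cast_injective (R := ℤ))]
  unfold toZ
  rw [Finset.image_image, Finset.image_image]
  rfl

theorem exists_colCard_le {s t : Finset (ℕ × ℕ)} (hc : Cvx (toZ s))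
    (h : ∀ k, 1 ≤ k → Dom (rowsk s k) (rowsk t k)) (j : ℤ) :
    ∃ j', colCard (toZ s) j ≤ colCard (toZ t) j' := by
  rcases Nat.eq_zero_or_pos (colCard (toZ s) j) with h0 | h0
  · exact ⟨0, by omega⟩
  obtain ⟨⟨i, _⟩, hx⟩ := Finset.card_pos.1 h0
  rw [Finset.mem_filter] at hx
  obtain ⟨hx, rfl⟩ := hx
  obtain ⟨a, b, hab, hcol⟩ := hc.tr.row (mem_transpose.2 hx)
  simp only [mem_transpose] at hcol
  obtain ⟨⟨r, c⟩, hrc, e⟩ := mem_toZ.1 ((hcol a).2 ⟨le_rfl, hab⟩)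
  simp only [Prod.mk.injEq] at e
  obtain ⟨rfl, rfl⟩ := e
  have hl := colCard_transpose (transpose (toZ s)) c
  rw [transpose_transpose, rowCard_eq (p := r) (q := b + 1) fun y => by
    rw [mem_transpose, hcol]; omega] at hl
  set l := colCard (toZ s) c
  obtain ⟨r', hr'⟩ := exists_overlapRow_le (h l h0) r
  have h1 : 0 < overlapRow s l r := by
    rw [overlapRow_eq]
    refine Finset.card_pos.2 ⟨(r, c), Finset.mem_filter.2 ⟨natCast_mem_toZ.2 hrc, rfl, fun n hn => ?_⟩⟩
    rw [hcol]
    dsimp only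
    omega
  obtain ⟨c', hc'⟩ := Finset.card_pos.1 (h1.trans_le hr')
  have h2 := (Finset.mem_filter.1 hc').2
  refine ⟨c', ?_⟩
  rw [← Finset.card_range l]
  refine Finset.card_le_card_of_injOn (fun n => (((r' + n : ℕ) : ℤ), (c' : ℤ))) (fun n hn => ?_)
    fun n _ n' _ e => by simpa using e
  rw [Finset.coe_range, Set.mem_Iio] at hn
  simp only [Finset.coe_filter, Set.mem_ofPred_eq, and_true]
  exact natCast_mem_toZ.2 (mem_rowCols.1 (h2 n hn))

theorem rowCard_toZ_neg (s : Finset (ℕ × ℕ)) {i : ℤ} (hi : i < 0) : rowCard (toZ s) i = 0 := by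
  refine rowCard_eq_zero fun j hj => ?_
  obtain ⟨c, -, e⟩ := mem_toZ.1 hj
  rw [Prod.mk.injEq] at e
  omega

theorem exists_rowCard_le {s t : Finset (ℕ × ℕ)} (h : Dom (rowsk s 1) (rowsk t 1)) (i : ℤ) :
    ∃ i', rowCard (toZ s) i ≤ rowCard (toZ t) i' := by
  rcases lt_or_ge i 0 with hi | hi
  · exact ⟨0, by rw [rowCard_toZ_neg s hi]; exact Nat.zero_le _⟩
  · lift i to ℕ using hi
    obtain ⟨i', hi'⟩ := exists_overlapRow_le h i
    rw [overlapRow_one, overlapRow_one] at hi'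
    exact ⟨i', hi'⟩

theorem exists_pairOverlap_le {s t : Finset (ℕ × ℕ)} (h : Dom (rowsk s 2) (rowsk t 2)) (i : ℤ) :
    ∃ i', pairOverlap (toZ s) i ≤ pairOverlap (toZ t) i' := by
  rcases lt_or_ge i 0 with hi | hi
  · refine ⟨0, le_of_eq_of_le (Nat.le_zero.1 ?_) (Nat.zero_le _)⟩
    rw [← rowCard_toZ_neg s hi]
    exact Finset.card_le_card (Finset.filter_subset_filter _ (Finset.filter_subset _ _))
  · lift i to ℕ using hi
    obtain ⟨i', hi'⟩ := exists_overlapRow_le h i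
    rw [overlapRow_two, overlapRow_two] at hi'
    exact ⟨i', hi'⟩

theorem cvx_toZ_cells (A : SkewShape) : Cvx (toZ A.cells) := by
  intro i j i' j' x y h h' h1 h2 h3 h4
  obtain ⟨⟨a, b⟩, hc, e⟩ := mem_toZ.1 h
  obtain ⟨⟨a', b'⟩, hc', e'⟩ := mem_toZ.1 h'
  simp only [Prod.mk.injEq] at e e'
  obtain ⟨rfl, rfl⟩ := e
  obtain ⟨rfl, rfl⟩ := e'
  lift x to ℕ using by omega
  lift y to ℕ using by omega
  simp only [Nat.cast_le] at h1 h2 h3 h4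
  rw [natCast_mem_toZ]
  unfold SkewShape.cells at *
  rw [Finset.mem_sdiff] at *
  refine ⟨A.lam.isLowerSet (show (x, y) ≤ (a', b') from ⟨h2, h4⟩) hc'.1, fun hm => hc.2 ?_⟩
  exact A.mu.isLowerSet (show (a, b) ≤ (x, y) from ⟨h1, h3⟩) hm

theorem SYT.entry_le {A : SkewShape} (T : SYT A) {c c' : ℕ × ℕ} (hc : c ∈ A.cells)
    (hc' : c' ∈ A.cells) (h1 : c.1 ≤ c'.1) (h2 : c.2 ≤ c'.2) : T.entry c ≤ T.entry c' := by
  have hm : (c.1, c'.2) ∈ A.cells := by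
    rw [← natCast_mem_toZ]
    exact cvx_toZ_cells A (natCast_mem_toZ.2 hc) (natCast_mem_toZ.2 hc') le_rfl (by simpa using h1)
      (by simpa using h2) le_rfl
  have e1 : T.entry c ≤ T.entry (c.1, c'.2) := by
    rcases h2.eq_or_lt with h | h
    · rw [← h]
    · exact (T.row_lt _ _ _ hc hm h).le
  refine e1.trans ?_
  rcases h1.eq_or_lt with h | h
  · rw [h]
  · exact (T.col_lt _ _ _ hm hc' h).le

/-- The tableau `T` numbers the cells of `A` in the order in which `L` lists them. -/
structure SYT.Lists {A : SkewShape} (T : SYT A) (L : List (ℤ × ℤ)) : Prop where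
  lin : IsLin (toZ A.cells) L
  get : ∀ c ∈ A.cells, L[T.entry c - 1]? = some ((c.1 : ℤ), (c.2 : ℤ))

theorem length_of_isLin_toZ {A : SkewShape} {L : List (ℤ × ℤ)} (h : IsLin (toZ A.cells) L) :
    L.length = A.size := by
  rw [h.length_eq, card_toZ]
  rfl

theorem SYT.exists_entry_eq {A : SkewShape} (T : SYT A) {k : ℕ} (hk : k < A.size) :
    ∃ c ∈ A.cells, T.entry c = k + 1 := by
  have := Finset.surj_on_of_inj_on_of_card_le (s := A.cells) (t := Finset.Icc 1 A.size)
    (fun c _ => T.entry c) (fun c hc => T.mem_range c hc)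
    (fun a b ha hb e => T.injOn ha hb e) (by simp [SkewShape.size]) (k + 1)
    (by rw [Finset.mem_Icc]; omega)
  obtain ⟨c, hc, e⟩ := this
  exact ⟨c, hc, e.symm⟩

theorem SYT.exists_lists {A : SkewShape} (T : SYT A) : ∃ L, T.Lists L := by
  have hex : ∀ k, ∃ c, k < A.size → c ∈ A.cells ∧ T.entry c = k + 1 := fun k => by
    by_cases hk : k < A.size
    · obtain ⟨c, h⟩ := T.exists_entry_eq hk
      exact ⟨c, fun _ => h⟩
    · exact ⟨0, fun h => absurd h hk⟩
  choose f hf using hex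
  have hinv : ∀ c ∈ A.cells, T.entry c - 1 < A.size ∧ f (T.entry c - 1) = c := fun c hc => by
    have h1 := Finset.mem_Icc.1 (T.mem_range c hc)
    have h2 := hf (T.entry c - 1) (by omega)
    exact ⟨by omega, T.injOn h2.1 hc (by omega)⟩
  refine ⟨(List.range A.size).map fun k => (((f k).1 : ℤ), ((f k).2 : ℤ)), ⟨fun x => ?_, ?_⟩,
    fun c hc => ?_⟩
  · rw [List.mem_map, mem_toZ]
    constructor
    · rintro ⟨k, hk, rfl⟩
      exact ⟨f k, (hf k (List.mem_range.1 hk)).1, rfl⟩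
    · rintro ⟨c, hc, rfl⟩
      exact ⟨T.entry c - 1, List.mem_range.2 (hinv c hc).1, by rw [(hinv c hc).2]⟩
  · rw [List.pairwise_map]
    refine List.Pairwise.imp_of_mem ?_ (List.pairwise_lt_range (n := A.size))
    rintro k k' hk hk' hlt ⟨h1, h2⟩
    have e := hf k (List.mem_range.1 hk)
    have e' := hf k' (List.mem_range.1 hk')
    have := T.entry_le e'.1 e.1 (by simpa using h1) (by simpa using h2)
    omega
  · rw [List.getElem?_map, List.getElem?_range (hinv c hc).1, Option.map_some, (hinv c hc).2]

theorem IsLin.idxOf_lt {s : Finset (ℤ × ℤ)} {L : List (ℤ × ℤ)} (h : IsLin s L) {a b : ℤ × ℤ}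
    (ha : a ∈ s) (hb : b ∈ s) (h1 : a.1 ≤ b.1) (h2 : a.2 ≤ b.2) (hne : a ≠ b) :
    L.idxOf a < L.idxOf b := by
  have ha' := List.idxOf_lt_length_iff.2 ((h.mem a).2 ha)
  have hb' := List.idxOf_lt_length_iff.2 ((h.mem b).2 hb)
  rcases lt_trichotomy (L.idxOf a) (L.idxOf b) with hlt | heq | hgt
  · exact hlt
  · exact absurd ((List.idxOf_inj ((h.mem a).2 ha)).1 heq) hne
  · have := List.pairwise_iff_getElem.1 h.pw _ _ hb' ha' hgt
    rw [List.getElem_idxOf, List.getElem_idxOf] at this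
    exact absurd ⟨h1, h2⟩ this

theorem IsLin.exists_lists {A : SkewShape} {L : List (ℤ × ℤ)} (h : IsLin (toZ A.cells) L) :
    ∃ T : SYT A, T.Lists L := by
  have hm : ∀ c ∈ A.cells, ((c.1 : ℤ), (c.2 : ℤ)) ∈ L := fun c hc =>
    (h.mem _).2 (natCast_mem_toZ.2 hc)
  have hlt : ∀ c ∈ A.cells, ∀ c' ∈ A.cells, c.1 ≤ c'.1 → c.2 ≤ c'.2 → c ≠ c' →
      L.idxOf ((c.1 : ℤ), (c.2 : ℤ)) < L.idxOf ((c'.1 : ℤ), (c'.2 : ℤ)) :=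
    fun c hc c' hc' h1 h2 hne => h.idxOf_lt (natCast_mem_toZ.2 hc) (natCast_mem_toZ.2 hc')
      (by simpa using h1) (by simpa using h2) fun e => hne (natCast_pair_injective e)
  refine ⟨⟨fun c => if c ∈ A.cells then L.idxOf ((c.1 : ℤ), (c.2 : ℤ)) + 1 else 0,
    fun c hc => if_neg hc, fun c hc => ?_, fun c hc c' hc' e => ?_,
    fun i j j' hc hc' hl => ?_, fun i i' j hc hc' hl => ?_⟩, h, fun c hc => ?_⟩
  · rw [if_pos hc, Finset.mem_Icc, ← length_of_isLin_toZ h]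
    have := List.idxOf_lt_length_iff.2 (hm c hc)
    omega
  · rw [Finset.mem_coe] at hc hc'
    simp only [if_pos hc, if_pos hc', Nat.add_right_cancel_iff] at e
    exact natCast_pair_injective ((List.idxOf_inj (hm c hc)).1 e)
  · simp only [if_pos hc, if_pos hc']
    exact Nat.succ_lt_succ (hlt _ hc _ hc' le_rfl hl.le (by simp [hl.ne]))
  · simp only [if_pos hc, if_pos hc']
    exact Nat.succ_lt_succ (hlt _ hc _ hc' hl.le le_rfl (by simp [hl.ne]))
  · simp only [if_pos hc, Nat.add_sub_cancel]
    exact List.getElem?_idxOf (hm c hc)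

theorem SYT.Lists.get_eq {A : SkewShape} {T : SYT A} {L : List (ℤ × ℤ)} (h : T.Lists L)
    {k : ℕ} {c : ℕ × ℕ} (hc : c ∈ A.cells) (e : T.entry c = k + 1) :
    L[k]? = some ((c.1 : ℤ), (c.2 : ℤ)) := by
  have := h.get c hc
  rwa [e, Nat.add_sub_cancel] at this

theorem SYT.Lists.unique {A : SkewShape} {T : SYT A} {L L' : List (ℤ × ℤ)} (h : T.Lists L)
    (h' : T.Lists L') : L = L' := by
  refine List.ext_getElem? fun k => ?_
  by_cases hk : k < A.size
  · obtain ⟨c, hc, e⟩ := T.exists_entry_eq hk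
    rw [h.get_eq hc e, h'.get_eq hc e]
  · rw [List.getElem?_eq_none, List.getElem?_eq_none]
    · rw [length_of_isLin_toZ h'.lin]; omega
    · rw [length_of_isLin_toZ h.lin]; omega

theorem des_getElem?_eq_true {L : List (ℤ × ℤ)} {k : ℕ} : (des L)[k]? = some true ↔
    ∃ a b, L[k]? = some a ∧ L[k + 1]? = some b ∧ a.1 < b.1 := by
  induction L generalizing k with
  | nil => simp [des]
  | cons a L ih =>
    cases L with
    | nil => simp [des]
    | cons b L =>
      cases k with
      | zero => simp [des]
      | succ k => simpa [des] using ih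

/-- The positions, counted from one, of the letters `true` in the word `β`. -/
def trueSet (n : ℕ) (β : List Bool) : Finset ℕ :=
  (Finset.Ico 1 n).filter fun k => β[k - 1]? = some true

theorem SYT.Lists.descentSet_eq {A : SkewShape} {T : SYT A} {L : List (ℤ × ℤ)} (h : T.Lists L) :
    T.descentSet = trueSet A.size (des L) := by
  refine Finset.filter_congr fun k hk => ?_
  obtain ⟨h1, h2⟩ := Finset.mem_Ico.1 hk
  obtain ⟨k, rfl⟩ := Nat.exists_eq_add_of_le' h1
  rw [Nat.add_sub_cancel, des_getElem?_eq_true]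
  constructor
  · rintro ⟨c, hc, c', hc', e, e', hlt⟩
    exact ⟨_, _, h.get_eq hc e, h.get_eq hc' e', by simpa using hlt⟩
  · rintro ⟨a, b, ha, hb, hlt⟩
    obtain ⟨c, hc, e⟩ := T.exists_entry_eq (k := k) (by omega)
    obtain ⟨c', hc', e'⟩ := T.exists_entry_eq h2
    rw [h.get_eq hc e, Option.some.injEq] at ha
    rw [h.get_eq hc' e', Option.some.injEq] at hb
    subst ha hb
    exact ⟨c, hc, c', hc', e, e', by simpa using hlt⟩

theorem FMultFree.multFree {A : SkewShape} (hA : FMultFree A) : MultFree (toZ A.cells) := by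
  intro L L' hL hL' e
  obtain ⟨T, hT⟩ := hL.exists_lists
  obtain ⟨T', hT'⟩ := hL'.exists_lists
  obtain rfl := hA T T' (by rw [hT.descentSet_eq, hT'.descentSet_eq, e])
  exact hT.unique hT'

theorem fsupp_subset_fsupp {A B : SkewShape} (hsize : A.size = B.size)
    (h : Supp (toZ B.cells) ⊆ Supp (toZ A.cells)) : Fsupp B ⊆ Fsupp A := by
  rintro α ⟨T, rfl⟩
  obtain ⟨L, hL⟩ := T.exists_lists
  obtain ⟨L', hL', e⟩ := h ⟨L, hL.lin, rfl⟩
  obtain ⟨T', hT'⟩ := hL'.exists_lists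
  refine ⟨T', ?_⟩
  unfold SYT.descentComp
  rw [hT'.descentSet_eq, hL.descentSet_eq, e, hsize]

theorem stmt19 (A B : SkewShape) (hA : FMultFree A) (hB : FMultFree B)
    (hsize : A.size = B.size)
    (hdom : ∀ k, 1 ≤ k → Dom (rowsk A.cells k) (rowsk B.cells k)) :
    Fsupp B ⊆ Fsupp A := by
  refine fsupp_subset_fsupp hsize (supp_subset_supp hA.multFree hB.multFree (cvx_toZ_cells A)
    (cvx_toZ_cells B) ?_ (exists_rowCard_le (hdom 1 le_rfl))
    (exists_colCard_le (cvx_toZ_cells A) hdom) (exists_pairOverlap_le (hdom 2 one_le_two)) ?_)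
  · rw [card_toZ, card_toZ]
    exact hsize
  · rw [card_image_fst_toZ, card_image_fst_toZ]
    exact card_image_fst_le (hdom 1 le_rfl) hsize

end SkewPaper
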